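/- Let T be a complete arithmetically definable theory in a countable arithmetically definable language with no finite models. If T is D-categorical for some nonzero arithmetic degree D, then T is arithmetically stable. -/

import Mathlib

open FirstOrder FirstOrder.Language

namespace ArMorley

/-! ## Arithmetical sets and arithmetic reducibility -/

/-- Function symbols of the language of arithmetic: `0`, `1`, `+`, `·`. -/
inductive ArFunc : ℕ → Type
  | zero : ArFunc 0
  | one : ArFunc 0
  | add : ArFunc 2
  | mul : ArFunc 2

/-- Relation symbols: `<` and a unary oracle predicate. -/
inductive ArRel : ℕ → Type
  | lt : ArRel 2
  | mem : ArRel 1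

/-- The language `(+, ·, 0, 1, <, Y)` of arithmetic with a unary oracle predicate. -/
def arithLang : FirstOrder.Language := ⟨ArFunc, ArRel⟩

/-- The standard structure on `ℕ`, with the oracle predicate interpreted by `Y`. -/
def arithStructure (Y : Set ℕ) : arithLang.Structure ℕ where
  funMap := fun {n} f =>
    match f with
    | ArFunc.zero => fun _ => 0
    | ArFunc.one => fun _ => 1
    | ArFunc.add => fun v => v 0 + v 1
    | ArFunc.mul => fun v => v 0 * v 1
  RelMap := fun {n} r =>
    match r with
    | ArRel.lt => fun v => v 0 < v 1
    | ArRel.mem => fun v => v 0 ∈ Y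

/-- `X ≤_ar Y` : `X` is definable without parameters in `(ℕ, +, ·, 0, 1, <, Y)`. -/
def ArReducible (X Y : Set ℕ) : Prop :=
  letI := arithStructure Y
  ∃ φ : arithLang.Formula (Fin 1), X = { n : ℕ | φ.Realize (fun _ => n) }

/-- `X` is arithmetical: definable without parameters in `(ℕ, +, ·, 0, 1, <)`. -/
def IsArithmetical (X : Set ℕ) : Prop := ArReducible X ∅

/-- `X` and `Y` have the same arithmetic degree. -/
def ArEquiv (X Y : Set ℕ) : Prop := ArReducible X Y ∧ ArReducible Y X

/-! ## Coding conventions -/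

/-- Code of a list of naturals. -/
def listCode (l : List ℕ) : ℕ := Encodable.encode l

/-- Code of a finite tuple of naturals. -/
def tupleCode {n : ℕ} (v : Fin n → ℕ) : ℕ := listCode (List.ofFn v)

/-- The subset of `ℕ` corresponding to a set of elements of a coded domain. -/
def subCode {A : Set ℕ} (S : Set ↥A) : Set ℕ := Subtype.val '' S

/-- Code of a set of `n`-tuples from a coded domain as a subset of `ℕ`. -/
def tupleSetCode {A : Set ℕ} {n : ℕ} (X : Set (Fin n → ↥A)) : Set ℕ :=
  { c : ℕ | ∃ v ∈ X, c = tupleCode (fun i => ((v i : ℕ))) }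

/-- Code of the graph of a function between coded domains. -/
def graphCode {A B : Set ℕ} (f : ↥A → ↥B) : Set ℕ :=
  { c : ℕ | ∃ a : ↥A, c = Nat.pair (a : ℕ) ((f a : ℕ)) }

/-! ## Gödel coded languages -/

/-- A fixed Gödel coding of the symbols of a countable first-order language. -/
structure GoedelCoding (L : FirstOrder.Language) where
  encFun : ∀ n, L.Functions n → ℕ
  encFun_inj : ∀ n, Function.Injective (encFun n)
  encRel : ∀ n, L.Relations n → ℕ
  encRel_inj : ∀ n, Function.Injective (encRel n)

variable {L : FirstOrder.Language}

/-- The set of codes of the symbols of `L`. -/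
def symbolCodes (g : GoedelCoding L) : Set ℕ :=
  { c | (∃ (n : ℕ) (f : L.Functions n), c = Nat.pair 0 (Nat.pair n (g.encFun n f))) ∨
        (∃ (n : ℕ) (R : L.Relations n), c = Nat.pair 1 (Nat.pair n (g.encRel n R))) }

/-- `L` is an arithmetically definable language. -/
def ArithLang (g : GoedelCoding L) : Prop := IsArithmetical (symbolCodes g)

/-- Code of a term, with a given coding of the variables. -/
def termCode (g : GoedelCoding L) {α : Type} (encα : α → ℕ) (t : L.Term α) : ℕ :=
  listCode (t.listEncode.map (Sum.elim (fun a => Nat.pair 0 (encα a))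
    (fun p => Nat.pair 1 (Nat.pair p.1 (g.encFun p.1 p.2)))))

/-- Code of a (bounded) formula, with a given coding of free variables. -/
def formulaCode (g : GoedelCoding L) {α : Type} (encα : α → ℕ) {n : ℕ}
    (φ : L.BoundedFormula α n) : ℕ :=
  listCode (φ.listEncode.map (Sum.elim
    (fun p => Nat.pair 0 (Nat.pair p.1
      (termCode g (Sum.elim (fun a => Nat.pair 0 (encα a)) (fun i => Nat.pair 1 i.1)) p.2)))
    (Sum.elim
      (fun q => Nat.pair 1 (Nat.pair q.1 (g.encRel q.1 q.2)))
      (fun m => Nat.pair 2 m))))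

/-- Code of a sentence. -/
def sentenceCode (g : GoedelCoding L) (φ : L.Sentence) : ℕ :=
  formulaCode g (fun a : Empty => a.elim) φ

/-- The set of codes of the axioms of a theory. -/
def theoryCode (g : GoedelCoding L) (T : L.Theory) : Set ℕ :=
  { c | ∃ φ ∈ T, c = sentenceCode g φ }

/-- `T` is an arithmetically definable theory. -/
def ArithTheory (g : GoedelCoding L) (T : L.Theory) : Prop := IsArithmetical (theoryCode g T)

/-! ## Coded structures -/

/-- A coded `L`-structure: an `L`-structure whose domain is a subset of `ℕ`
with infinite complement. -/
structure CodedStructure (L : FirstOrder.Language) where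
  carrier : Set ℕ
  compl_infinite : (carrierᶜ : Set ℕ).Infinite
  struc : L.Structure ↥carrier

/-- A coded structure is a model of `T`. -/
def CodedStructure.Models (M : CodedStructure L) (T : L.Theory) : Prop :=
  ∀ φ ∈ T, @Sentence.Realize L ↥M.carrier M.struc φ

/-- The (coded) elementary diagram of a coded structure. -/
def elemDiagram (g : GoedelCoding L) (M : CodedStructure L) : Set ℕ :=
  { c | ∃ (k : ℕ) (φ : L.Formula (Fin k)) (a : Fin k → ↥M.carrier),
      c = Nat.pair (Nat.pair k (formulaCode g Fin.val φ)) (tupleCode fun i => ((a i : ℕ))) ∧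
      (letI := M.struc; φ.Realize a) }

/-- A coded structure is arithmetically decidable if its elementary diagram is arithmetical. -/
def ArithDecidable (g : GoedelCoding L) (M : CodedStructure L) : Prop :=
  IsArithmetical (elemDiagram g M)

/-- `M ≼ N` for coded structures: `M`'s domain is contained in `N`'s, and the
inclusion is elementary. -/
structure ElemSub (M N : CodedStructure L) : Prop where
  subset : M.carrier ⊆ N.carrier
  elem : ∀ (k : ℕ) (φ : L.Formula (Fin k)) (a : Fin k → ↥M.carrier),
    (letI := M.struc; φ.Realize a) ↔
      (letI := N.struc; φ.Realize (fun i => (⟨((a i : ℕ)), subset (a i).2⟩ : ↥N.carrier)))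

/-- A coded model of `T` is arithmetically extendible if it is an elementary substructure of
an arithmetically decidable coded model of `T`. -/
def ArithExtendible (g : GoedelCoding L) (T : L.Theory) (M : CodedStructure L) : Prop :=
  ∃ N : CodedStructure L, ArithDecidable g N ∧ N.Models T ∧ ElemSub M N

/-! ## Model-theoretic notions in arbitrary structures -/

/-- `N` (with structure `SN`) is a model of `T`. -/
def ModelsT (L : FirstOrder.Language) (T : L.Theory) (N : Type) (SN : L.Structure N) : Prop :=
  ∀ φ ∈ T, @Sentence.Realize L N SN φ

/-- `T` has no finite models. -/
def NoFiniteModels (L : FirstOrder.Language) (T : L.Theory) : Prop :=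
  ∀ (N : Type) (SN : L.Structure N), ModelsT L T N SN → Infinite N

/-- Elementary embeddings, with the structures given explicitly. -/
def EEmb (L : FirstOrder.Language) (M : Type) (SM : L.Structure M)
    (N : Type) (SN : L.Structure N) : Type _ :=
  @FirstOrder.Language.ElementaryEmbedding L M N SM SN

/-- The underlying map of an elementary embedding. -/
def EEmb.fn {L : FirstOrder.Language} {M : Type} {SM : L.Structure M}
    {N : Type} {SN : L.Structure N} (j : EEmb L M SM N SN) : M → N :=
  @FirstOrder.Language.ElementaryEmbedding.toFun L M N SM SN j

/-- A subset of `N^n` definable with parameters from `P`. -/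
def DefinableOverT (L : FirstOrder.Language) (N : Type) (SN : L.Structure N) (P : Set N)
    {n : ℕ} (X : Set (Fin n → N)) : Prop :=
  letI := SN
  ∃ (m : ℕ) (ψ : L.Formula (Fin n ⊕ Fin m)) (b : Fin m → N),
    (∀ i, b i ∈ P) ∧ X = { v | ψ.Realize (Sum.elim v b) }

/-- A subset of `N` definable with (arbitrary) parameters. -/
def Definable1 (L : FirstOrder.Language) (N : Type) (SN : L.Structure N) (Y : Set N) : Prop :=
  letI := SN
  ∃ (m : ℕ) (ψ : L.Formula (Fin 1 ⊕ Fin m)) (b : Fin m → N),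
    Y = { x : N | ψ.Realize (Sum.elim (fun _ => x) b) }

/-- The algebraic closure of `B` in `N`: elements satisfying a formula with parameters
from `B` having finitely many solutions. -/
def aclIn (L : FirstOrder.Language) (N : Type) (SN : L.Structure N) (B : Set N) : Set N :=
  letI := SN
  { a : N | ∃ (k : ℕ) (φ : L.Formula (Fin 1 ⊕ Fin k)) (b : Fin k → N),
      (∀ i, b i ∈ B) ∧ φ.Realize (Sum.elim (fun _ => a) b) ∧
      { x : N | φ.Realize (Sum.elim (fun _ => x) b) }.Finite }

/-- The domain of the substructure of `N` generated by `B`: values of terms at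
arguments from `B`. -/
def genSub (L : FirstOrder.Language) (N : Type) (SN : L.Structure N) (B : Set N) : Set N :=
  letI := SN
  { a : N | ∃ (t : L.Term ℕ) (v : ℕ → N), (∀ i, v i ∈ B) ∧ a = t.realize v }

/-- The set defined by a formula `φ(x, p̄)` in one free variable with parameters `p̄`. -/
def smSet (L : FirstOrder.Language) (N : Type) (SN : L.Structure N) {k : ℕ}
    (φ : L.Formula (Fin 1 ⊕ Fin k)) (p : Fin k → N) : Set N :=
  letI := SN
  { x : N | φ.Realize (Sum.elim (fun _ => x) p) }

/-- A definable tuple-set in a coded structure, with parameters from `P`. -/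
def DefinableOver (M : CodedStructure L) (P : Set ↥M.carrier) {n : ℕ}
    (X : Set (Fin n → ↥M.carrier)) : Prop :=
  DefinableOverT L ↥M.carrier M.struc P X

/-- A definable tuple-set in a coded structure, with arbitrary parameters. -/
def DefinableIn (M : CodedStructure L) {n : ℕ} (X : Set (Fin n → ↥M.carrier)) : Prop :=
  DefinableOver M Set.univ X

/-! ## Isomorphisms of coded structures and `D`-categoricity -/

/-- An isomorphism of coded `L`-structures. -/
structure CodedIso (M N : CodedStructure L) where
  toFun : ↥M.carrier → ↥N.carrier
  invFun : ↥N.carrier → ↥M.carrier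
  left_inv : Function.LeftInverse invFun toFun
  right_inv : Function.RightInverse invFun toFun
  map_fun : ∀ {k : ℕ} (f : L.Functions k) (v : Fin k → ↥M.carrier),
    toFun (M.struc.funMap f v) = N.struc.funMap f (toFun ∘ v)
  map_rel : ∀ {k : ℕ} (r : L.Relations k) (v : Fin k → ↥M.carrier),
    M.struc.RelMap r v ↔ N.struc.RelMap r (toFun ∘ v)

/-- `f` is a `D`-preserving isomorphism, where `d` is a representative of the
arithmetic degree `D`. -/
def DPreserving (d : Set ℕ) {M N : CodedStructure L} (f : CodedIso M N) : Prop :=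
  ArReducible (graphCode f.toFun) d ∧
  ArReducible (graphCode f.invFun) d ∧
  (∀ (n : ℕ) (X : Set (Fin n → ↥M.carrier)), DefinableIn M X →
      ArEquiv (tupleSetCode X) d →
      ArEquiv (tupleSetCode ((fun v => f.toFun ∘ v) '' X)) d) ∧
  (∀ (n : ℕ) (Y : Set (Fin n → ↥N.carrier)), DefinableIn N Y →
      ArEquiv (tupleSetCode Y) d →
      ArEquiv (tupleSetCode ((fun v => f.invFun ∘ v) '' Y)) d)

/-- `T` is `D`-categorical, where `d` is a representative of the nonzero
arithmetic degree `D`. -/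
def DCategorical (g : GoedelCoding L) (T : L.Theory) (d : Set ℕ) : Prop :=
  ∀ M₀ M₁ M₂ : CodedStructure L,
    ArithDecidable g M₀ → M₀.Models T →
    M₁.Models T → ArithExtendible g T M₁ →
    M₂.Models T → ArithExtendible g T M₂ →
    ElemSub M₀ M₁ → ElemSub M₀ M₂ →
    ArEquiv M₁.carrier d → ArEquiv M₂.carrier d →
    ∃ f : CodedIso M₁ M₂, DPreserving d f ∧
      ∀ (x : ℕ) (hx : x ∈ M₀.carrier) (h₁ : x ∈ M₁.carrier),
        ((f.toFun ⟨x, h₁⟩ : ℕ)) = x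

/-! ## Vaughtian pairs, prime models, strong minimality -/

/-- `T` has a Vaughtian pair. -/
def HasVaughtianPair (T : L.Theory) : Prop :=
  ∃ (N : Type) (SN : L.Structure N),
    ModelsT L T N SN ∧
    ∃ S : @FirstOrder.Language.ElementarySubstructure L N SN,
      ((S.toSubstructure : Set N) ≠ Set.univ ∧
      ∃ (k : ℕ) (φ : L.Formula (Fin 1 ⊕ Fin k)) (a : Fin k → N),
        (∀ i, a i ∈ (S.toSubstructure : Set N)) ∧
        smSet L N SN φ a ⊆ (S.toSubstructure : Set N) ∧
        (smSet L N SN φ a).Infinite)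

/-- A coded model of `T` is prime: it elementarily embeds into every model of `T`. -/
def PrimeModel (L : FirstOrder.Language) (T : L.Theory) (P : CodedStructure L) : Prop :=
  P.Models T ∧ ∀ (N : Type) (SN : L.Structure N), ModelsT L T N SN →
    Nonempty (EEmb L ↥P.carrier P.struc N SN)

/-- `φ(x, p̄)` is strongly minimal over the coded model `M`: its solution set in `M` is
infinite, and in every elementary extension of `M` modelling `T` every definable subset of
its solution set is finite or cofinite in it. -/
def StronglyMinimalOver (T : L.Theory) (M : CodedStructure L) {k : ℕ}
    (φ : L.Formula (Fin 1 ⊕ Fin k)) (p : Fin k → ↥M.carrier) : Prop :=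
  (smSet L ↥M.carrier M.struc φ p).Infinite ∧
  ∀ (N : Type) (SN : L.Structure N), ModelsT L T N SN →
    ∀ j : EEmb L ↥M.carrier M.struc N SN,
      ∀ Y : Set N, Definable1 L N SN Y →
        Y ⊆ smSet L N SN φ (fun i => j.fn (p i)) →
        (Y.Finite ∨ ((smSet L N SN φ (fun i => j.fn (p i))) \ Y).Finite)

/-- `T` is a strongly minimal theory: every model is infinite, and every
parameter-definable subset of any model is finite or cofinite. -/
def StronglyMinimalTheory (L : FirstOrder.Language) (T : L.Theory) : Prop :=
  (∀ (N : Type) (SN : L.Structure N), ModelsT L T N SN → Infinite N) ∧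
  (∀ (N : Type) (SN : L.Structure N), ModelsT L T N SN →
    ∀ Y : Set N, Definable1 L N SN Y → (Y.Finite ∨ (Yᶜ : Set N).Finite))

/-- The structural control clause: an arithmetically decidable prime model together with
a strongly minimal formula over it generating every elementary extension. -/
def GeneratesAll (T : L.Theory) (P : CodedStructure L) {k : ℕ}
    (φ : L.Formula (Fin 1 ⊕ Fin k)) (p : Fin k → ↥P.carrier) : Prop :=
  ∀ (N : Type) (SN : L.Structure N), ModelsT L T N SN →
    ∀ j : EEmb L ↥P.carrier P.struc N SN,
      aclIn L N SN (Set.range j.fn ∪ smSet L N SN φ (fun i => j.fn (p i))) = Set.univ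

/-- Clause (3) of the arithmetic Baldwin–Lachlan theorem. -/
def SMControl (g : GoedelCoding L) (T : L.Theory) : Prop :=
  ∃ (P : CodedStructure L), ArithDecidable g P ∧ PrimeModel L T P ∧
    ∃ (k : ℕ) (φ : L.Formula (Fin 1 ⊕ Fin k)) (p : Fin k → ↥P.carrier),
      StronglyMinimalOver T P φ p ∧ GeneratesAll T P φ p

/-! ## Types and arithmetical stability -/

/-- A formula with a finite parameter tuple from a coded structure, in `n` object
variables. -/
def ParamFormula (L : FirstOrder.Language) (M : CodedStructure L) (n : ℕ) : Type :=
  Σ k : ℕ, L.Formula (Fin n ⊕ Fin k) × (Fin k → ↥M.carrier)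

/-- All parameters of `q` lie in `A`. -/
def paramsIn {M : CodedStructure L} {n : ℕ} (A : Set ℕ) (q : ParamFormula L M n) : Prop :=
  ∀ i, ((q.2.2 i : ℕ)) ∈ A

/-- `p` is consistent with the elementary diagram of `M`: it is realized in some
elementary extension of `M`. -/
def TypeConsistent (M : CodedStructure L) {n : ℕ} (p : Set (ParamFormula L M n)) : Prop :=
  ∃ (N : Type) (SN : L.Structure N) (j : EEmb L ↥M.carrier M.struc N SN) (b : Fin n → N),
    ∀ q ∈ p, letI := SN; q.2.1.Realize (Sum.elim b (fun i => j.fn (q.2.2 i)))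

/-- `p` is a (complete) `n`-type over `A` inside `M`: a maximal set of formulas with
parameters from `A` consistent with the elementary diagram of `M`. -/
def IsNType (M : CodedStructure L) (A : Set ℕ) (n : ℕ)
    (p : Set (ParamFormula L M n)) : Prop :=
  (∀ q ∈ p, paramsIn A q) ∧
  TypeConsistent M p ∧
  ∀ q : ParamFormula L M n, paramsIn A q → q ∉ p → ¬ TypeConsistent M (insert q p)

/-- The code of a formula-with-parameters. -/
def pfCode (g : GoedelCoding L) {M : CodedStructure L} {n : ℕ} (q : ParamFormula L M n) : ℕ :=
  Nat.pair
    (Nat.pair q.1 (formulaCode g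
      (Sum.elim (fun i : Fin n => Nat.pair 0 i.1) (fun j : Fin q.1 => Nat.pair 1 j.1)) q.2.1))
    (tupleCode fun i => ((q.2.2 i : ℕ)))

/-- The set of codes of the formulas of `p`. -/
def typeCode (g : GoedelCoding L) {M : CodedStructure L} {n : ℕ}
    (p : Set (ParamFormula L M n)) : Set ℕ :=
  { c | ∃ q ∈ p, c = pfCode g q }

/-- `p` is realized in the coded elementary extension `N` of `M`. -/
def RealizesType {M N : CodedStructure L} (h : M.carrier ⊆ N.carrier) {n : ℕ}
    (p : Set (ParamFormula L M n)) : Prop :=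
  ∃ b : Fin n → ↥N.carrier, ∀ q ∈ p,
    letI := N.struc
    q.2.1.Realize (Sum.elim b (fun i => (⟨((q.2.2 i : ℕ)), h (q.2.2 i).2⟩ : ↥N.carrier)))

/-- The `(n, i)`-th column of an effective join. -/
def tripleSection (X : Set ℕ) (n i : ℕ) : Set ℕ := { m | Nat.pair n (Nat.pair i m) ∈ X }

/-- `T` is arithmetically stable: over every arithmetically decidable model and every
arithmetical parameter set, the family of arithmetic `n`-types (for all `n ≥ 1`) has a
uniform arithmetical code in which every arithmetic `n`-type appears at least once. -/
def ArithStable (g : GoedelCoding L) (T : L.Theory) : Prop :=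
  ∀ M : CodedStructure L, ArithDecidable g M → M.Models T →
    ∀ A : Set ℕ, A ⊆ M.carrier → IsArithmetical A →
      ∃ X : Set ℕ, IsArithmetical X ∧
        (∀ n, 1 ≤ n → ∀ i : ℕ, ∃ p : Set (ParamFormula L M n),
            IsNType M A n p ∧ IsArithmetical (typeCode g p) ∧
            tripleSection X n i = typeCode g p) ∧
        (∀ n, 1 ≤ n → ∀ p : Set (ParamFormula L M n),
            IsNType M A n p → IsArithmetical (typeCode g p) →
            ∃ i : ℕ, tripleSection X n i = typeCode g p)

/-- The set of elements occurring as a coordinate of a tuple in `X`. -/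
def coordSet {N : Type} {n : ℕ} (X : Set (Fin n → N)) : Set N :=
  { m | ∃ v ∈ X, ∃ i, v i = m }

/-! ## Definable predicates on tuples of naturals -/

/-- The predicate `P` on tuples is definable in `(ℕ, +, ·, 0, 1, <, Y)`. -/
def DefPred (Y : Set ℕ) {α : Type} (P : (α → ℕ) → Prop) : Prop :=
  letI := arithStructure Y
  ∃ φ : arithLang.Formula α, ∀ v : α → ℕ, φ.Realize v ↔ P v

/-- The function `t` on tuples has a definable graph in `(ℕ, +, ·, 0, 1, <, Y)`. -/
def DefTerm (Y : Set ℕ) {α : Type} (t : (α → ℕ) → ℕ) : Prop :=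
  DefPred Y (fun w : Option α → ℕ => t (fun a => w (some a)) = w none)

namespace DefPred
variable {Y : Set ℕ} {α β : Type} {P Q : (α → ℕ) → Prop}

theorem of_iff (h : DefPred Y P) (H : ∀ v, P v ↔ Q v) : DefPred Y Q := by
  obtain ⟨φ, hφ⟩ := h
  exact ⟨φ, fun v => (hφ v).trans (H v)⟩

theorem not (h : DefPred Y P) : DefPred Y (fun v => ¬ P v) := by
  let := arithStructure Y
  obtain ⟨φ, hφ⟩ := h
  exact ⟨φ.not, fun v => by rw [Formula.realize_not, hφ]⟩

theorem and (h : DefPred Y P) (h' : DefPred Y Q) : DefPred Y (fun v => P v ∧ Q v) := by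
  let := arithStructure Y
  obtain ⟨φ, hφ⟩ := h
  obtain ⟨ψ, hψ⟩ := h'
  exact ⟨φ ⊓ ψ, fun v => by rw [Formula.realize_inf, hφ, hψ]⟩

theorem or (h : DefPred Y P) (h' : DefPred Y Q) : DefPred Y (fun v => P v ∨ Q v) :=
  (h.not.and h'.not).not.of_iff fun v => by tauto

theorem imp (h : DefPred Y P) (h' : DefPred Y Q) : DefPred Y (fun v => P v → Q v) :=
  (h.and h'.not).not.of_iff fun v => by tauto

theorem preimage (f : α → β) (h : DefPred Y P) :
    DefPred Y (fun v : β → ℕ => P (fun a => v (f a))) := by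
  let := arithStructure Y
  obtain ⟨φ, hφ⟩ := h
  exact ⟨φ.relabel f, fun v => by rw [Formula.realize_relabel, hφ]; rfl⟩

theorem ex {R : (α → ℕ) → ℕ → Prop}
    (h : DefPred Y (fun w : Option α → ℕ => R (fun a => w (some a)) (w none))) :
    DefPred Y (fun v => ∃ y, R v y) := by
  let := arithStructure Y
  obtain ⟨φ, hφ⟩ := h
  let f : Option α → α ⊕ Unit := fun o => o.elim (Sum.inr ()) Sum.inl
  refine ⟨(φ.relabel f).iExs Unit, fun v => ?_⟩
  rw [Formula.realize_iExs]
  constructor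
  · rintro ⟨i, hi⟩
    rw [Formula.realize_relabel, hφ] at hi
    exact ⟨i (), hi⟩
  · rintro ⟨y, hy⟩
    refine ⟨fun _ => y, ?_⟩
    rw [Formula.realize_relabel, hφ]
    exact hy

theorem all {R : (α → ℕ) → ℕ → Prop}
    (h : DefPred Y (fun w : Option α → ℕ => R (fun a => w (some a)) (w none))) :
    DefPred Y (fun v => ∀ y, R v y) :=
  (ex (R := fun v y => ¬ R v y) h.not).not.of_iff fun v => by simp

theorem subst {R : (α → ℕ) → ℕ → Prop} {t : (α → ℕ) → ℕ}
    (h : DefPred Y (fun w : Option α → ℕ => R (fun a => w (some a)) (w none)))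
    (ht : DefTerm Y t) : DefPred Y (fun v => R v (t v)) :=
  (ex (R := fun v y => t v = y ∧ R v y) (DefPred.and ht h)).of_iff fun v => by simp

end DefPred

namespace DefTerm
variable {Y : Set ℕ} {α β : Type}

theorem var (a : α) : DefTerm Y (fun v => v a) := by
  let := arithStructure Y
  exact ⟨(Term.var (some a)).equal (Term.var none), fun v => by
    rw [Formula.realize_equal]; rfl⟩

theorem weaken {t : (α → ℕ) → ℕ} (f : α → β) (h : DefTerm Y t) :
    DefTerm Y (fun v : β → ℕ => t (fun a => v (f a))) :=
  DefPred.preimage (Option.map f) h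

/-- Functions given by a term of the language of arithmetic are definable. -/
theorem func {n : ℕ} (f : arithLang.Functions n) :
    DefTerm Y (fun v : Fin n → ℕ => (arithStructure Y).funMap f v) := by
  let := arithStructure Y
  exact ⟨(Term.func f (fun i => Term.var (some i))).equal (Term.var none), fun v => by
    rw [Formula.realize_equal]; rfl⟩

theorem zero : DefTerm Y (fun _ : α → ℕ => 0) :=
  (func (Y := Y) (n := 0) ArFunc.zero).weaken (fun i : Fin 0 => i.elim0)

theorem one : DefTerm Y (fun _ : α → ℕ => 1) :=
  (func (Y := Y) (n := 0) ArFunc.one).weaken (fun i : Fin 0 => i.elim0)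

theorem comp₁ {f : ℕ → ℕ} (hf : DefTerm Y (fun v : Fin 1 → ℕ => f (v 0)))
    {t : (α → ℕ) → ℕ} (ht : DefTerm Y t) : DefTerm Y (fun v => f (t v)) := by
  refine DefPred.subst (α := Option α) (R := fun w y => f y = w none)
    (t := fun w => t (fun a => w (some a))) ?_ (ht.weaken some)
  exact DefPred.preimage (fun o : Option (Fin 1) => o.elim (some none) (fun _ => none)) hf

theorem comp₂ {f : ℕ → ℕ → ℕ} (hf : DefTerm Y (fun v : Fin 2 → ℕ => f (v 0) (v 1)))
    {t u : (α → ℕ) → ℕ} (ht : DefTerm Y t) (hu : DefTerm Y u) :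
    DefTerm Y (fun v => f (t v) (u v)) := by
  refine DefPred.subst (α := Option α) (R := fun w y => f y (u (fun a => w (some a))) = w none)
    (t := fun w => t (fun a => w (some a))) ?_ (ht.weaken some)
  refine DefPred.subst (α := Option (Option α)) (R := fun w y => f (w none) y = w (some none))
    (t := fun w => u (fun a => w (some (some a)))) ?_ (hu.weaken (some ∘ some))
  exact DefPred.preimage
    (fun o : Option (Fin 2) => o.elim (some (some none)) ![some none, none]) hf

theorem add {t u : (α → ℕ) → ℕ} (ht : DefTerm Y t) (hu : DefTerm Y u) :
    DefTerm Y (fun v => t v + u v) :=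
  comp₂ (func (Y := Y) (n := 2) ArFunc.add) ht hu

theorem mul {t u : (α → ℕ) → ℕ} (ht : DefTerm Y t) (hu : DefTerm Y u) :
    DefTerm Y (fun v => t v * u v) :=
  comp₂ (func (Y := Y) (n := 2) ArFunc.mul) ht hu

theorem eq {t u : (α → ℕ) → ℕ} (ht : DefTerm Y t) (hu : DefTerm Y u) :
    DefPred Y (fun v => t v = u v) :=
  DefPred.subst (R := fun v y => t v = y) ht hu

theorem lt {t u : (α → ℕ) → ℕ} (ht : DefTerm Y t) (hu : DefTerm Y u) :
    DefPred Y (fun v => t v < u v) := by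
  refine (DefPred.ex (R := fun v y => t v + (y + 1) = u v) ?_).of_iff fun v => ?_
  · exact ((ht.weaken some).add ((var none).add one)).eq (hu.weaken some)
  · constructor
    · rintro ⟨y, hy⟩; omega
    · intro h; exact ⟨u v - t v - 1, by omega⟩

theorem mem {t : (α → ℕ) → ℕ} (ht : DefTerm Y t) : DefPred Y (fun v => t v ∈ Y) := by
  let := arithStructure Y
  refine DefPred.subst (R := fun _ y => y ∈ Y) ?_ ht
  refine ⟨Relations.formula (L := arithLang) (n := 1) ArRel.mem ![Term.var none], fun v => Iff.rfl⟩

theorem mod {t u : (α → ℕ) → ℕ} (ht : DefTerm Y t) (hu : DefTerm Y u) :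
    DefTerm Y (fun v => t v % u v) := by
  refine comp₂ (f := fun x y => x % y) ?_ ht hu
  refine DefPred.of_iff (P := fun w : Option (Fin 2) → ℕ =>
    (w (some 1) = 0 ∧ w none = w (some 0)) ∨ (w none < w (some 1) ∧
      ∃ q, w (some 0) = w (some 1) * q + w none)) ?_ ?_
  · refine DefPred.or (((var _).eq zero).and ((var _).eq (var _))) (((var _).lt (var _)).and ?_)
    exact DefPred.ex (R := fun w q => w (some 0) = w (some 1) * q + w none)
      ((var _).eq (((var _).mul (var _)).add (var _)))
  · intro w
    beta_reduce
    constructor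
    · rintro (⟨h, h'⟩ | ⟨h, q, h'⟩)
      · simp [h, h']
      · rw [h', Nat.mul_add_mod, Nat.mod_eq_of_lt h]
    · intro h
      rcases Nat.eq_zero_or_pos (w (some 1)) with h0 | h0
      · left
        rw [h0, Nat.mod_zero] at h
        exact ⟨h0, h.symm⟩
      · right
        rw [← h]
        exact ⟨Nat.mod_lt _ h0, w (some 0) / w (some 1), (Nat.div_add_mod _ _).symm⟩

theorem pair {t u : (α → ℕ) → ℕ} (ht : DefTerm Y t) (hu : DefTerm Y u) :
    DefTerm Y (fun v => Nat.pair (t v) (u v)) := by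
  refine comp₂ (f := Nat.pair) ?_ ht hu
  refine DefPred.of_iff (P := fun w : Option (Fin 2) → ℕ =>
    (w (some 0) < w (some 1) ∧ w (some 1) * w (some 1) + w (some 0) = w none) ∨
    (¬ (w (some 0) < w (some 1)) ∧
      w (some 0) * w (some 0) + w (some 0) + w (some 1) = w none)) ?_ ?_
  · exact DefPred.or (((var _).lt (var _)).and ((((var _).mul (var _)).add (var _)).eq (var _)))
      (((var _).lt (var _)).not.and
        (((((var _).mul (var _)).add (var _)).add (var _)).eq (var _)))
  · intro w
    beta_reduce
    unfold Nat.pair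
    split_ifs with h <;> simp [h]

theorem left {t : (α → ℕ) → ℕ} (ht : DefTerm Y t) : DefTerm Y (fun v => (t v).unpair.1) := by
  refine comp₁ (f := fun n => n.unpair.1) ?_ ht
  refine (DefPred.ex (R := fun (w : Option (Fin 1) → ℕ) y => Nat.pair (w none) y = w (some 0))
    (((var _).pair (var _)).eq (var _))).of_iff fun w => ?_
  beta_reduce
  constructor
  · rintro ⟨y, hy⟩
    rw [← hy, Nat.unpair_pair]
  · intro h
    exact ⟨(w (some 0)).unpair.2, by rw [← h, Nat.pair_unpair]⟩

theorem right {t : (α → ℕ) → ℕ} (ht : DefTerm Y t) : DefTerm Y (fun v => (t v).unpair.2) := by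
  refine comp₁ (f := fun n => n.unpair.2) ?_ ht
  refine (DefPred.ex (R := fun (w : Option (Fin 1) → ℕ) y => Nat.pair y (w none) = w (some 0))
    (((var _).pair (var _)).eq (var _))).of_iff fun w => ?_
  beta_reduce
  constructor
  · rintro ⟨y, hy⟩
    rw [← hy, Nat.unpair_pair]
  · intro h
    exact ⟨(w (some 0)).unpair.1, by rw [← h, Nat.pair_unpair]⟩

theorem beta {t u : (α → ℕ) → ℕ} (ht : DefTerm Y t) (hu : DefTerm Y u) :
    DefTerm Y (fun v => Nat.beta (t v) (u v)) :=
  ht.left.mod (((hu.add one).mul ht.right).add one)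

theorem of_nat_primrec {f : ℕ → ℕ} (hf : Nat.Primrec f) :
    DefTerm Y (fun v : Fin 1 → ℕ => f (v 0)) := by
  induction hf with
  | zero => exact zero
  | succ => exact (var 0).add one
  | left => exact (var 0).left
  | right => exact (var 0).right
  | pair _ _ hf hg => exact hf.pair hg
  | comp _ _ hf hg => exact comp₁ hf hg
  | @prec f g _ _ hf hg =>
    refine DefPred.of_iff (P := fun w : Option (Fin 1) → ℕ => ∃ c,
      Nat.beta c 0 = f (w (some 0)).unpair.1 ∧
      (∀ y, y < (w (some 0)).unpair.2 → Nat.beta c (y + 1) =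
        g (Nat.pair (w (some 0)).unpair.1 (Nat.pair y (Nat.beta c y)))) ∧
      Nat.beta c (w (some 0)).unpair.2 = w none) ?_ ?_
    · refine DefPred.ex (R := fun (w : Option (Fin 1) → ℕ) c =>
        Nat.beta c 0 = f (w (some 0)).unpair.1 ∧
        (∀ y, y < (w (some 0)).unpair.2 → Nat.beta c (y + 1) =
          g (Nat.pair (w (some 0)).unpair.1 (Nat.pair y (Nat.beta c y)))) ∧
        Nat.beta c (w (some 0)).unpair.2 = w none) ?_
      refine (((var _).beta zero).eq (comp₁ hf (var _).left)).and
        (DefPred.and ?_ (((var _).beta (var _).right).eq (var _)))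
      refine DefPred.all (R := fun (w : Option (Option (Fin 1)) → ℕ) y =>
        y < (w (some (some 0))).unpair.2 → Nat.beta (w none) (y + 1) =
          g (Nat.pair (w (some (some 0))).unpair.1 (Nat.pair y (Nat.beta (w none) y)))) ?_
      exact ((var _).lt (var _).right).imp
        (((var _).beta ((var _).add one)).eq
          (comp₁ hg ((var _).left.pair ((var _).pair ((var _).beta (var _))))))
    · intro w
      simp only [Nat.unpaired]
      set z := (w (some 0)).unpair.1
      set n := (w (some 0)).unpair.2
      let r : ℕ → ℕ := fun n => Nat.rec (f z) (fun y IH => g (Nat.pair z (Nat.pair y IH))) n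
      constructor
      · rintro ⟨c, h0, hs, hn⟩
        have key : ∀ k ≤ n, Nat.beta c k = r k := by
          intro k
          induction k with
          | zero => intro _; exact h0
          | succ k ih =>
            intro hk
            rw [hs k (by omega), ih (by omega)]
        rw [← hn, key n le_rfl]
      · intro h
        let l := (List.range (n + 1)).map r
        have key : ∀ k ≤ n, Nat.beta (Nat.unbeta l) k = r k := by
          intro k hk
          have := Nat.beta_unbeta_coe l ⟨k, by simp [l]; omega⟩
          rw [this]
          simp [l]
        refine ⟨Nat.unbeta l, key 0 (by omega), fun y hy => ?_, ?_⟩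
        · rw [key _ (by omega), key y (by omega)]
        · rw [key n le_rfl]
          exact h

end DefTerm

/-! ## Arithmetical predicates and functions on coded types -/

/-- The predicate `P` on a coded type is arithmetical in `Y`. -/
def Ar (Y : Set ℕ) {α : Type} [Primcodable α] (P : α → Prop) : Prop :=
  DefPred Y (fun v : Fin 1 → ℕ => ∃ a : α, Encodable.encode a = v 0 ∧ P a)

/-- The function `f` between coded types is arithmetical in `Y`. -/
@[fun_prop]
def ArFun (Y : Set ℕ) {α β : Type} [Primcodable α] [Primcodable β] (f : α → β) : Prop :=
  Ar Y (fun p : α × β => f p.1 = p.2)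

theorem arReducible_iff {X Y : Set ℕ} : ArReducible X Y ↔ Ar Y (fun n => n ∈ X) := by
  let := arithStructure Y
  constructor
  · rintro ⟨φ, rfl⟩
    refine ⟨φ, fun v => ?_⟩
    have : v = fun _ => v 0 := funext fun i => by rw [Subsingleton.elim i 0]
    constructor
    · intro h
      exact ⟨v 0, rfl, by rw [this] at h; exact h⟩
    · rintro ⟨a, h, h'⟩
      rw [this, ← h]
      exact h'
  · rintro ⟨φ, hφ⟩
    refine ⟨φ, Set.ext fun n => ?_⟩
    constructor
    · intro h
      exact (hφ (fun _ => n)).2 ⟨n, rfl, h⟩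
    · intro h
      obtain ⟨a, h, h'⟩ := (hφ (fun _ => n)).1 h
      have : a = n := h
      exact this ▸ h'

section Mono
variable {α : Type}

theorem realize_arith_term (Y Z : Set ℕ) (t : arithLang.Term α) (v : α → ℕ) :
    @Term.realize _ _ (arithStructure Y) _ v t = @Term.realize _ _ (arithStructure Z) _ v t := by
  induction t with
  | var => rfl
  | func f ts ih =>
    simp only [Term.realize, ih]
    rfl

theorem exists_oracle_formula (Y : Set ℕ) {n : ℕ} (φ : arithLang.BoundedFormula α n) :
    ∃ ψ : arithLang.BoundedFormula α n, ∀ v xs,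
      @BoundedFormula.Realize _ _ (arithStructure Y) _ _ ψ v xs ↔
        @BoundedFormula.Realize _ _ (arithStructure ∅) _ _ φ v xs := by
  induction φ with
  | falsum => exact ⟨.falsum, fun _ _ => Iff.rfl⟩
  | equal t₁ t₂ =>
    refine ⟨.equal t₁ t₂, fun v xs => ?_⟩
    simp only [BoundedFormula.Realize, realize_arith_term Y ∅]
  | @rel _ l R ts =>
    match l, R, ts with
    | _, ArRel.lt, ts =>
      refine ⟨.rel (L := arithLang) (l := 2) ArRel.lt ts, fun v xs => ?_⟩
      simp only [BoundedFormula.Realize, realize_arith_term Y ∅]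
      rfl
    | _, ArRel.mem, ts => exact ⟨.falsum, fun _ _ => Iff.rfl⟩
  | imp _ _ ih₁ ih₂ =>
    obtain ⟨ψ₁, h₁⟩ := ih₁
    obtain ⟨ψ₂, h₂⟩ := ih₂
    refine ⟨.imp ψ₁ ψ₂, fun v xs => ?_⟩
    simp only [BoundedFormula.Realize, h₁, h₂]
  | all _ ih =>
    obtain ⟨ψ, h⟩ := ih
    refine ⟨.all ψ, fun v xs => ?_⟩
    simp only [BoundedFormula.Realize, h]

end Mono

section
variable {Y : Set ℕ} {α β γ δ : Type} [Primcodable α] [Primcodable β] [Primcodable γ]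
  [Primcodable δ]

theorem defPred_mem_range_encode {ι : Type} {t : (ι → ℕ) → ℕ} (ht : DefTerm Y t) (α : Type)
    [Primcodable α] : DefPred Y (fun v => ∃ a : α, Encodable.encode a = t v) := by
  refine (DefTerm.eq (DefTerm.comp₁ (DefTerm.of_nat_primrec (Primcodable.prim (α := α))) ht)
    (ht.add .one)).of_iff fun v => ?_
  constructor
  · intro h
    cases hd : (Encodable.decode (t v) : Option α) with
    | none => simp [hd] at h
    | some a => exact ⟨a, by simpa [hd] using h⟩
  · rintro ⟨a, ha⟩
    rw [← ha]
    simp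

namespace Ar

theorem mono {P : α → Prop} (h : Ar ∅ P) : Ar Y P := by
  obtain ⟨φ, hφ⟩ := h
  obtain ⟨ψ, hψ⟩ := exists_oracle_formula Y φ
  exact ⟨ψ, fun v => (hψ v _).trans (hφ v)⟩

theorem defPred {P : α → Prop} (h : Ar Y P) {ι : Type} {t : (ι → ℕ) → ℕ} (ht : DefTerm Y t) :
    DefPred Y (fun v => ∃ a : α, Encodable.encode a = t v ∧ P a) := by
  refine DefPred.subst (R := fun _ y => ∃ a : α, Encodable.encode a = y ∧ P a) ?_ ht
  exact DefPred.preimage (fun _ : Fin 1 => none) h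

variable {P Q : α → Prop}

theorem of_iff (h : Ar Y P) (H : ∀ a, P a ↔ Q a) : Ar Y Q :=
  (funext fun a => propext (H a) : P = Q) ▸ h

theorem not (h : Ar Y P) : Ar Y (fun a => ¬ P a) := by
  refine ((defPred_mem_range_encode (DefTerm.var 0) α).and (DefPred.not h)).of_iff fun v => ?_
  constructor
  · rintro ⟨⟨a, ha⟩, h⟩
    exact ⟨a, ha, fun h' => h ⟨a, ha, h'⟩⟩
  · rintro ⟨a, ha, h⟩
    refine ⟨⟨a, ha⟩, ?_⟩
    rintro ⟨b, hb, h'⟩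
    rw [Encodable.encode_injective (ha.trans hb.symm)] at h
    exact h h'

theorem and (h : Ar Y P) (h' : Ar Y Q) : Ar Y (fun a => P a ∧ Q a) := by
  refine (DefPred.and h h').of_iff fun v => ?_
  constructor
  · rintro ⟨⟨a, ha, h⟩, ⟨b, hb, h'⟩⟩
    rw [Encodable.encode_injective (hb.trans ha.symm)] at h'
    exact ⟨a, ha, h, h'⟩
  · rintro ⟨a, ha, h, h'⟩
    exact ⟨⟨a, ha, h⟩, ⟨a, ha, h'⟩⟩

theorem or (h : Ar Y P) (h' : Ar Y Q) : Ar Y (fun a => P a ∨ Q a) :=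
  (h.not.and h'.not).not.of_iff fun a => by tauto

theorem imp (h : Ar Y P) (h' : Ar Y Q) : Ar Y (fun a => P a → Q a) :=
  (h.and h'.not).not.of_iff fun a => by tauto

theorem iff (h : Ar Y P) (h' : Ar Y Q) : Ar Y (fun a => P a ↔ Q a) :=
  ((h.imp h').and (h'.imp h)).of_iff fun a => by tauto

theorem ex {R : α → β → Prop} (h : Ar Y (fun p : α × β => R p.1 p.2)) :
    Ar Y (fun a => ∃ b, R a b) := by
  refine (DefPred.ex (R := fun (v : Fin 1 → ℕ) m =>
    ∃ p : α × β, Encodable.encode p = Nat.pair (v 0) m ∧ R p.1 p.2)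
    (h.defPred ((DefTerm.var _).pair (DefTerm.var _)))).of_iff fun v => ?_
  constructor
  · rintro ⟨m, ⟨a, b⟩, h, h'⟩
    rw [Encodable.encode_prod_val, Nat.pair_eq_pair] at h
    exact ⟨a, h.1, b, h'⟩
  · rintro ⟨a, ha, b, h⟩
    exact ⟨Encodable.encode b, (a, b), by rw [Encodable.encode_prod_val, ha], h⟩

theorem all {R : α → β → Prop} (h : Ar Y (fun p : α × β => R p.1 p.2)) :
    Ar Y (fun a => ∀ b, R a b) :=
  (ex (R := fun a b => ¬ R a b) h.not).not.of_iff fun a => by simp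

theorem comp {P : β → Prop} (h : Ar Y P) {f : α → β} (hf : ArFun Y f) :
    Ar Y (fun a => P (f a)) := by
  refine (DefPred.ex (R := fun (v : Fin 1 → ℕ) m =>
    (∃ p : α × β, Encodable.encode p = Nat.pair (v 0) m ∧ f p.1 = p.2) ∧
      ∃ b : β, Encodable.encode b = m ∧ P b)
    ((hf.defPred ((DefTerm.var _).pair (DefTerm.var _))).and
      (h.defPred (DefTerm.var _)))).of_iff fun v => ?_
  constructor
  · rintro ⟨m, ⟨⟨a, b⟩, h, rfl : f a = b⟩, b', hb', hP⟩
    rw [Encodable.encode_prod_val, Nat.pair_eq_pair] at h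
    have := Encodable.encode_injective (hb'.trans h.2.symm)
    rw [this] at hP
    exact ⟨a, h.1, hP⟩
  · rintro ⟨a, ha, h⟩
    exact ⟨Encodable.encode (f a), ⟨(a, f a), by rw [Encodable.encode_prod_val, ha], rfl⟩,
      f a, rfl, h⟩

theorem oracle {f : α → ℕ} (hf : ArFun Y f) : Ar Y (fun a => f a ∈ Y) := by
  refine comp (P := fun n => n ∈ Y) ?_ hf
  exact (DefTerm.mem (DefTerm.var 0)).of_iff fun v => by simp

end Ar

namespace ArFun

theorem mono {f : α → β} (h : ArFun ∅ f) : ArFun Y f := Ar.mono h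

theorem of_primrec {f : α → β} (hf : Primrec f) : ArFun Y f := by
  refine ((defPred_mem_range_encode (DefTerm.var 0) (α × β)).and
    ((DefTerm.comp₁ (DefTerm.of_nat_primrec hf) (DefTerm.var 0).left).eq
      ((DefTerm.var 0).right.add .one))).of_iff fun v => ?_
  constructor
  · rintro ⟨⟨⟨a, b⟩, h⟩, h'⟩
    refine ⟨(a, b), h, ?_⟩
    rw [← h] at h'
    simpa using h'
  · rintro ⟨⟨a, b⟩, h, rfl : f a = b⟩
    refine ⟨⟨(a, f a), h⟩, ?_⟩
    rw [← h]
    simp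

@[fun_prop]
theorem id : ArFun Y (fun a : α => a) := of_primrec Primrec.id

@[fun_prop]
theorem const (b : β) : ArFun Y (fun _ : α => b) := of_primrec (Primrec.const b)

theorem eq {f g : α → β} (hf : ArFun Y f) (hg : ArFun Y g) : Ar Y (fun a => f a = g a) := by
  have h₁ : Ar Y (fun p : α × β => g p.1 = p.2) := hg
  have h₂ : Ar Y (fun p : α × β => f p.1 = p.2) := hf
  exact (Ar.ex (R := fun a b => f a = b ∧ g a = b) (h₂.and h₁)).of_iff fun a => by simp [eq_comm]

@[fun_prop]
theorem comp {g : β → γ} {f : α → β} (hg : ArFun Y g) (hf : ArFun Y f) :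
    ArFun Y (fun a => g (f a)) := by
  have h₁ : ArFun Y (fun p : (α × γ) × β => (p.2, p.1.2)) :=
    of_primrec (Primrec.pair Primrec.snd (Primrec.snd.comp Primrec.fst))
  have h₂ : ArFun Y (fun p : (α × γ) × β => (p.1.1, p.2)) :=
    of_primrec (Primrec.pair (Primrec.fst.comp Primrec.fst) Primrec.snd)
  refine (Ar.ex (R := fun (p : α × γ) b => f p.1 = b ∧ g b = p.2)
    ((Ar.comp hf h₂).and (Ar.comp hg h₁))).of_iff fun a => by simp

@[fun_prop]
theorem fst : ArFun Y (Prod.fst : α × β → α) := of_primrec Primrec.fst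

@[fun_prop]
theorem snd : ArFun Y (Prod.snd : α × β → β) := of_primrec Primrec.snd

@[fun_prop]
theorem prodMk {f : α → β} {g : α → γ} (hf : ArFun Y f) (hg : ArFun Y g) :
    ArFun Y (fun a => (f a, g a)) := by
  have h₁ : ArFun Y (fun p : α × β × γ => (p.1, p.2.1)) :=
    of_primrec (Primrec.pair Primrec.fst (Primrec.fst.comp Primrec.snd))
  have h₂ : ArFun Y (fun p : α × β × γ => (p.1, p.2.2)) :=
    of_primrec (Primrec.pair Primrec.fst (Primrec.snd.comp Primrec.snd))
  exact ((Ar.comp hf h₁).and (Ar.comp hg h₂)).of_iff fun p => by simp [Prod.ext_iff]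

theorem of_primrec₂ {g : β → γ → δ} (hg : Primrec₂ g) {f₁ : α → β} {f₂ : α → γ}
    (h₁ : ArFun Y f₁) (h₂ : ArFun Y f₂) : ArFun Y (fun a => g (f₁ a) (f₂ a)) :=
  comp (g := fun p : β × γ => g p.1 p.2) (of_primrec hg) (prodMk h₁ h₂)

/-- A function is arithmetical as soon as its graph is. -/
theorem of_graph {f : α → β} {R : α → β → Prop} (h : Ar Y (fun p : α × β => R p.1 p.2))
    (H : ∀ a b, R a b ↔ f a = b) : ArFun Y f :=
  h.of_iff fun p => H p.1 p.2

@[fun_prop]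
theorem pair {f g : α → ℕ} (hf : ArFun Y f) (hg : ArFun Y g) :
    ArFun Y (fun a => Nat.pair (f a) (g a)) := of_primrec₂ Primrec₂.natPair hf hg

@[fun_prop]
theorem unpair {f : α → ℕ} (hf : ArFun Y f) : ArFun Y (fun a => (f a).unpair) :=
  (of_primrec Primrec.unpair).comp hf

@[fun_prop]
theorem add {f g : α → ℕ} (hf : ArFun Y f) (hg : ArFun Y g) :
    ArFun Y (fun a => f a + g a) := of_primrec₂ Primrec.nat_add hf hg

@[fun_prop]
theorem encode {f : α → β} (hf : ArFun Y f) : ArFun Y (fun a => Encodable.encode (f a)) :=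
  (of_primrec Primrec.encode).comp hf

@[fun_prop]
theorem some {f : α → β} (hf : ArFun Y f) : ArFun Y (fun a => Option.some (f a)) :=
  (of_primrec Primrec.option_some).comp hf

@[fun_prop]
theorem getElem? {f : α → List β} {g : α → ℕ} (hf : ArFun Y f) (hg : ArFun Y g) :
    ArFun Y (fun a => (f a)[g a]?) := of_primrec₂ Primrec.list_getElem? hf hg

@[fun_prop]
theorem getD {f : α → List ℕ} {g h : α → ℕ} (hf : ArFun Y f) (hg : ArFun Y g) (hh : ArFun Y h) :
    ArFun Y (fun a => (f a).getD (g a) (h a)) := by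
  have : ArFun Y (fun a => ((f a)[g a]?).getD (h a)) :=
    of_primrec₂ Primrec.option_getD (hf.getElem? hg) hh
  simpa only [List.getD_eq_getElem?_getD] using this

@[fun_prop]
theorem append {f g : α → List β} (hf : ArFun Y f) (hg : ArFun Y g) :
    ArFun Y (fun a => f a ++ g a) := of_primrec₂ Primrec.list_append hf hg

@[fun_prop]
theorem cons {f : α → β} {g : α → List β} (hf : ArFun Y f) (hg : ArFun Y g) :
    ArFun Y (fun a => f a :: g a) := of_primrec₂ Primrec.list_cons hf hg

@[fun_prop]
theorem length {f : α → List β} (hf : ArFun Y f) : ArFun Y (fun a => (f a).length) :=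
  (of_primrec Primrec.list_length).comp hf

theorem lt {f g : α → ℕ} (hf : ArFun Y f) (hg : ArFun Y g) : Ar Y (fun a => f a < g a) := by
  refine (Ar.ex (R := fun a (k : ℕ) => f a + (k + 1) = g a) (eq ?_ ?_)).of_iff fun a => ?_
  · fun_prop
  · fun_prop
  · constructor
    · rintro ⟨k, h⟩; omega
    · intro h; exact ⟨g a - f a - 1, by omega⟩

@[fun_prop]
theorem ite {c : α → Prop} [DecidablePred c] {f g : α → β} (hc : Ar Y c) (hf : ArFun Y f)
    (hg : ArFun Y g) : ArFun Y (fun a => if c a then f a else g a) := by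
  refine of_graph (R := fun a b => (c a ∧ f a = b) ∨ (¬ c a ∧ g a = b)) ?_ fun a b => ?_
  · exact ((hc.comp fst).and hf).or ((hc.comp fst).not.and hg)
  · by_cases h : c a <;> simp [h]

theorem natRec {f : α → β} {g : α → ℕ → β → β} (hf : ArFun Y f)
    (hg : ArFun Y (fun p : α × ℕ × β => g p.1 p.2.1 p.2.2)) :
    ArFun Y (fun p : α × ℕ => (Nat.rec (f p.1) (g p.1) p.2 : β)) := by
  refine of_graph (R := fun (p : α × ℕ) (b : β) => ∃ s : List β, s[0]? = Option.some (f p.1) ∧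
    (∀ i : ℕ, ∀ c : β, i < p.2 → s[i]? = Option.some c →
      s[i + 1]? = Option.some (g p.1 i c)) ∧ s[p.2]? = Option.some b) ?_ ?_
  · refine Ar.ex ((eq (by fun_prop) (by fun_prop)).and
      (Ar.and (Ar.all (Ar.all ((lt (by fun_prop) (by fun_prop)).imp ((eq (by fun_prop)
        (by fun_prop)).imp (eq (by fun_prop) ?_))))) (eq (by fun_prop) (by fun_prop))))
    exact some (hg.comp (f := fun p : ((((α × ℕ) × β) × List β) × ℕ) × β =>
      (p.1.1.1.1.1, p.1.2, p.2)) (by fun_prop))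
  · rintro ⟨a, n⟩ b
    let r : ℕ → β := fun n => Nat.rec (f a) (g a) n
    constructor
    · rintro ⟨s, h0, hs, hn⟩
      have key : ∀ k ≤ n, s[k]? = Option.some (r k) := by
        intro k
        induction k with
        | zero => intro _; exact h0
        | succ k ih => intro hk; exact hs k _ (by simpa using hk) (ih (by omega))
      have := (key n le_rfl).symm.trans hn
      exact Option.some_injective _ this
    · intro h
      refine ⟨(List.range (n + 1)).map r, by simp [r], fun i c hi hc => ?_, ?_⟩
      · have hi : i < n := hi
        simp only [List.getElem?_map] at hc ⊢
        rw [List.getElem?_range (by omega)] at hc ⊢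
        simp only [Option.map_some, Option.some_inj] at hc ⊢
        rw [← hc]
      · simp only [List.getElem?_map]
        rw [List.getElem?_range (by omega), ← h]
        rfl

theorem listMap {f : α → β → γ} {l : α → List β} (hf : ArFun Y (fun p : α × β => f p.1 p.2))
    (hl : ArFun Y l) : ArFun Y (fun a => (l a).map (f a)) := by
  refine of_graph (R := fun a m => ∀ i : ℕ,
    (∃ b, (l a)[i]? = Option.some b ∧ m[i]? = Option.some (f a b)) ∨
      ((l a)[i]? = none ∧ m[i]? = none)) ?_ fun a m => ?_
  · refine Ar.all (Ar.or (Ar.ex ((eq (by fun_prop) (by fun_prop)).and (eq (by fun_prop) ?_)))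
      ((eq (by fun_prop) (by fun_prop)).and (eq (by fun_prop) (by fun_prop))))
    exact some (hf.comp (f := fun p : ((α × List γ) × ℕ) × β => (p.1.1.1, p.2)) (by fun_prop))
  · rw [List.ext_getElem?_iff]
    refine forall_congr' fun i => ?_
    rw [List.getElem?_map]
    cases (l a)[i]? <;> simp [eq_comm]

open Classical in
/-- Bounded search relative to an arithmetical relation. -/
theorem find {R : α → ℕ → Prop} {d : α → ℕ} (hR : Ar Y (fun p : α × ℕ => R p.1 p.2))
    (hd : ArFun Y d) :
    ArFun Y (fun a => if h : ∃ n, R a n then Nat.find h else d a) := by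
  refine of_graph (R := fun a n => (R a n ∧ ∀ m, m < n → ¬ R a m) ∨
    ((¬ ∃ m, R a m) ∧ d a = n)) ?_ fun a n => ?_
  · refine (hR.and (Ar.all ((lt (by fun_prop) (by fun_prop)).imp
      (hR.comp (f := fun p : (α × ℕ) × ℕ => (p.1.1, p.2)) (by fun_prop)).not))).or
      (Ar.and (Ar.not (Ar.ex (hR.comp (f := fun p : (α × ℕ) × ℕ => (p.1.1, p.2))
        (by fun_prop)))) hd)
  · by_cases h : ∃ n, R a n
    · simp [h, Nat.find_eq_iff]
    · simp only [h, dif_neg, not_false_eq_true, true_and]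
      push Not at h
      simp [h]

end ArFun
end

/-! ## Arithmetical ultrafilters -/

section Ultra
variable {I : Type} (A B : ℕ → I → Prop)

/-- The point `x` follows the decisions `s` on the sets `A 0, A 1, …`. -/
def Follows (s : List ℕ) (x : I) : Prop := ∀ i b : ℕ, s[i]? = some b → (b = 1 ↔ A i x)

open Classical in
/-- Decide the next set positively iff this is consistent with the sets `B k`. -/
noncomputable def nextDecision (s : List ℕ) : ℕ :=
  if ∀ k : ℕ, ∃ x, (∀ i, i < k → B i x) ∧ Follows A s x ∧ A s.length x then 1 else 0

/-- The first `e` decisions. -/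
noncomputable def decisions (e : ℕ) : List ℕ :=
  Nat.rec [] (fun _ s => s ++ [nextDecision A B s]) e

variable {A B}

theorem decisions_succ (e : ℕ) :
    decisions A B (e + 1) = decisions A B e ++ [nextDecision A B (decisions A B e)] := rfl

theorem decisions_eq (e : ℕ) :
    decisions A B e = (List.range e).map fun i => nextDecision A B (decisions A B i) := by
  induction e with
  | zero => rfl
  | succ e ih => rw [decisions_succ, List.range_succ, List.map_append, ← ih]; rfl

theorem length_decisions (e : ℕ) : (decisions A B e).length = e := by
  rw [decisions_eq]; simp

theorem follows_decisions {e : ℕ} {x : I} : Follows A (decisions A B e) x ↔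
    ∀ i < e, (nextDecision A B (decisions A B i) = 1 ↔ A i x) := by
  rw [decisions_eq]
  constructor
  · intro h i hi
    refine h i _ ?_
    rw [List.getElem?_map, List.getElem?_range hi]
    rfl
  · intro h i b hb
    rw [List.getElem?_map] at hb
    by_cases hi : i < e
    · rw [List.getElem?_range hi] at hb
      obtain rfl : nextDecision A B (decisions A B i) = b := by simpa using hb
      exact h i hi
    · rw [List.getElem?_eq_none (by simpa using hi)] at hb
      simp at hb

theorem exists_follows (hB : ∀ k : ℕ, ∃ x, ∀ i < k, B i x) (e k : ℕ) :
    ∃ x, (∀ i < k, B i x) ∧ Follows A (decisions A B e) x := by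
  induction e generalizing k with
  | zero =>
    obtain ⟨x, hx⟩ := hB k
    exact ⟨x, hx, follows_decisions.2 (by simp)⟩
  | succ e ih =>
    by_cases h : ∀ k : ℕ, ∃ x, (∀ i, i < k → B i x) ∧ Follows A (decisions A B e) x ∧
      A (decisions A B e).length x
    · obtain ⟨x, hx, hf, hA⟩ := h k
      refine ⟨x, hx, follows_decisions.2 fun i hi => ?_⟩
      rcases Nat.lt_succ_iff_lt_or_eq.1 hi with hi | rfl
      · exact follows_decisions.1 hf i hi
      · rw [length_decisions] at hA
        simp only [hA, iff_true]
        exact if_pos h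
    · have h' := h
      push Not at h
      obtain ⟨k₀, hk₀⟩ := h
      obtain ⟨x, hx, hf⟩ := ih (max k k₀)
      refine ⟨x, fun i hi => hx i (lt_max_of_lt_left hi), follows_decisions.2 fun i hi => ?_⟩
      rcases Nat.lt_succ_iff_lt_or_eq.1 hi with hi | rfl
      · exact follows_decisions.1 hf i hi
      · have hA := hk₀ x (fun i hi => hx i (lt_max_of_lt_right hi)) hf
        rw [length_decisions] at hA
        simp only [hA, iff_false]
        rw [nextDecision, if_neg h']
        simp

variable [Primcodable I]

theorem arFun_decisions (hA : Ar ∅ (fun p : ℕ × I => A p.1 p.2))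
    (hB : Ar ∅ (fun p : ℕ × I => B p.1 p.2)) : ArFun ∅ (decisions A B) := by
  have h₁ : Ar ∅ (fun p : List ℕ × I => Follows A p.1 p.2) := by
    refine Ar.all (Ar.all ((ArFun.eq (by fun_prop) (by fun_prop)).imp
      ((ArFun.eq (by fun_prop) (by fun_prop)).iff ?_)))
    exact hA.comp (f := fun p : ((List ℕ × I) × ℕ) × ℕ => (p.1.2, p.1.1.2)) (by fun_prop)
  have h₂ : ArFun ∅ (nextDecision A B) := by
    classical
    refine ArFun.ite (Ar.all (Ar.ex (Ar.and (Ar.all ((ArFun.lt (by fun_prop) (by fun_prop)).imp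
      (hB.comp (f := fun p : ((List ℕ × ℕ) × I) × ℕ => (p.2, p.1.2)) (by fun_prop))))
      (Ar.and (h₁.comp (f := fun p : (List ℕ × ℕ) × I => (p.1.1, p.2)) (by fun_prop))
      (hA.comp (f := fun p : (List ℕ × ℕ) × I => (p.1.1.length, p.2)) (by fun_prop))))))
      (by fun_prop) (by fun_prop)
  exact (ArFun.natRec (f := fun _ : Unit => ([] : List ℕ))
    (g := fun _ _ s => s ++ [nextDecision A B s]) (by fun_prop) (by fun_prop)).comp
    (f := fun e : ℕ => ((), e)) (by fun_prop)

/-- An arithmetical sequence of sets with the finite intersection property lies in an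
ultrafilter whose trace on a given arithmetical sequence of sets is arithmetical. -/
theorem exists_ultrafilter (hA : Ar ∅ (fun p : ℕ × I => A p.1 p.2))
    (hB : Ar ∅ (fun p : ℕ × I => B p.1 p.2)) (hfip : ∀ k : ℕ, ∃ x, ∀ i < k, B i x) :
    ∃ U : Ultrafilter I, (∀ i, ∀ᶠ x in (U : Filter I), B i x) ∧
      Ar ∅ (fun e => ∀ᶠ x in (U : Filter I), A e x) := by
  let S : ℕ → Set I := fun k => {x | (∀ i < k, B i x) ∧ Follows A (decisions A B k) x}
  have hS : Antitone S := by
    intro k l hkl x hx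
    exact ⟨fun i hi => hx.1 i (hi.trans_le hkl), follows_decisions.2 fun i hi =>
      follows_decisions.1 hx.2 i (hi.trans_le hkl)⟩
  have hne : (⨅ k, Filter.principal (S k)).NeBot := by
    refine Filter.iInf_neBot_of_directed' ?_ fun k => ?_
    · exact Antitone.directed_ge fun _ _ h => Filter.principal_mono.2 (hS h)
    · exact Filter.principal_neBot_iff.2 (exists_follows hfip k k)
  let U := Ultrafilter.of (⨅ k, Filter.principal (S k))
  have hU : ∀ k, S k ∈ (U : Filter I) := fun k =>
    Ultrafilter.of_le _ (Filter.mem_iInf_of_mem k (Filter.mem_principal_self _))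
  refine ⟨U, fun i => Filter.mem_of_superset (hU (i + 1)) fun x hx => hx.1 i i.lt_succ_self, ?_⟩
  have h₃ : ArFun ∅ (decisions A B) := arFun_decisions hA hB
  have h₄ : Ar ∅ (fun e : ℕ => (decisions A B (e + 1))[e]? = some 1) :=
    ArFun.eq (by fun_prop) (by fun_prop)
  refine h₄.of_iff fun e => ?_
  have h₅ : (decisions A B (e + 1))[e]? = some 1 ↔ nextDecision A B (decisions A B e) = 1 := by
    rw [decisions_eq, List.getElem?_map, List.getElem?_range e.lt_succ_self]
    simp
  rw [h₅]
  constructor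
  · intro h
    exact Filter.mem_of_superset (hU (e + 1)) fun x hx =>
      (follows_decisions.1 hx.2 e e.lt_succ_self).1 h
  · intro h
    obtain ⟨x, hx, hx'⟩ := (h.and (hU (e + 1))).exists
    exact (follows_decisions.1 hx'.2 e e.lt_succ_self).2 hx

end Ultra

/-! ## Arithmetical Skolem functions -/

section Skolem
variable (C : Set ℕ) (Tr : ℕ → List ℕ → Prop) (m₀ : ℕ)

open Classical in
/-- `m` if it lies in the domain, and the default element otherwise. -/
noncomputable def clip (m : ℕ) : ℕ := if m ∈ C then m else m₀

/-- The `i`-th coordinate of a list, as an element of the domain. -/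
noncomputable def coord (l : List ℕ) (i : ℕ) : ℕ := clip C m₀ (l.getD i m₀)

open Classical in
/-- The least witness for the formula coded by `q` at the tuple `l`. -/
noncomputable def witness (q : ℕ) (l : List ℕ) : ℕ :=
  if h : ∃ y, y ∈ C ∧ Tr q (l ++ [y]) then Nat.find h else m₀

/-- The value at `x` of the next Skolem function, given the list `s` of the values of the
previous ones. -/
noncomputable def skolemStep (x : List ℕ × List ℕ) (s : List ℕ) : ℕ :=
  if s.length.unpair.1 = 0 then clip C m₀ s.length.unpair.2
  else if s.length.unpair.1 = 1 then coord C m₀ x.1 s.length.unpair.2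
  else if s.length.unpair.1 = 2 then coord C m₀ x.2 s.length.unpair.2
  else witness C Tr m₀ s.length.unpair.2.unpair.1
    (((Encodable.decode s.length.unpair.2.unpair.2 : Option (List ℕ)).getD []).map
      fun j => s.getD j m₀)

/-- The values at `x` of the first `e` Skolem functions. -/
noncomputable def skolemHist (x : List ℕ × List ℕ) (e : ℕ) : List ℕ :=
  Nat.rec [] (fun _ s => s ++ [skolemStep C Tr m₀ x s]) e

/-- The `e`-th Skolem function. -/
noncomputable def skolem (e : ℕ) (x : List ℕ × List ℕ) : ℕ :=
  skolemStep C Tr m₀ x (skolemHist C Tr m₀ x e)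

/-- The index of the Skolem function for the formula coded by `q` at the tuple of elements with
indices `l`. -/
def skolemIdx (q : ℕ) (l : List ℕ) : ℕ := Nat.pair 3 (Nat.pair q (Encodable.encode l))

variable {C Tr m₀}

theorem clip_of_mem {m : ℕ} (h : m ∈ C) : clip C m₀ m = m := if_pos h

theorem clip_mem (h : m₀ ∈ C) (m : ℕ) : clip C m₀ m ∈ C := by
  unfold clip
  split_ifs with hm
  · exact hm
  · exact h

theorem witness_mem (h : m₀ ∈ C) (q : ℕ) (l : List ℕ) : witness C Tr m₀ q l ∈ C := by
  classical
  unfold witness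
  split_ifs with hm
  · exact (Nat.find_spec hm).1
  · exact h

theorem witness_spec {q y : ℕ} {l : List ℕ} (hy : y ∈ C) (h : Tr q (l ++ [y])) :
    Tr q (l ++ [witness C Tr m₀ q l]) := by
  classical
  have hm : ∃ y, y ∈ C ∧ Tr q (l ++ [y]) := ⟨y, hy, h⟩
  unfold witness
  rw [dif_pos hm]
  exact (Nat.find_spec hm).2

theorem skolem_mem (h : m₀ ∈ C) (e : ℕ) (x : List ℕ × List ℕ) : skolem C Tr m₀ e x ∈ C := by
  unfold skolem skolemStep
  split_ifs
  · exact clip_mem h _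
  · exact clip_mem h _
  · exact clip_mem h _
  · exact witness_mem h _ _

theorem skolemHist_eq (x : List ℕ × List ℕ) (e : ℕ) :
    skolemHist C Tr m₀ x e = (List.range e).map fun j => skolem C Tr m₀ j x := by
  induction e with
  | zero => rfl
  | succ e ih => rw [List.range_succ, List.map_append, ← ih]; rfl

theorem length_skolemHist (x : List ℕ × List ℕ) (e : ℕ) :
    (skolemHist C Tr m₀ x e).length = e := by
  rw [skolemHist_eq]; simp

theorem skolem_const {m : ℕ} (h : m ∈ C) (x : List ℕ × List ℕ) :
    skolem C Tr m₀ (Nat.pair 0 m) x = m := by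
  simp [skolem, skolemStep, length_skolemHist, clip_of_mem h]

theorem skolem_fst (i : ℕ) (x : List ℕ × List ℕ) :
    skolem C Tr m₀ (Nat.pair 1 i) x = coord C m₀ x.1 i := by
  simp [skolem, skolemStep, length_skolemHist]

theorem skolem_snd (i : ℕ) (x : List ℕ × List ℕ) :
    skolem C Tr m₀ (Nat.pair 2 i) x = coord C m₀ x.2 i := by
  simp [skolem, skolemStep, length_skolemHist]

theorem le_encode_of_mem {l : List ℕ} {j : ℕ} (h : j ∈ l) : j ≤ Encodable.encode l := by
  induction l with
  | nil => simp at h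
  | cons a l ih =>
    rw [Encodable.encode_list_cons]
    rcases List.mem_cons.1 h with rfl | h
    · exact (Nat.left_le_pair j _).trans (Nat.le_succ _)
    · exact (ih h).trans ((Nat.right_le_pair _ _).trans (Nat.le_succ _))

theorem lt_skolemIdx {q j : ℕ} {l : List ℕ} (h : j ∈ l) : j < skolemIdx q l := by
  have h₁ := le_encode_of_mem h
  have h₂ := Nat.right_le_pair q (Encodable.encode l)
  have h₃ := Nat.add_le_pair 3 (Nat.pair q (Encodable.encode l))
  unfold skolemIdx
  omega

theorem skolem_idx (q : ℕ) (l : List ℕ) (x : List ℕ × List ℕ) :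
    skolem C Tr m₀ (skolemIdx q l) x =
      witness C Tr m₀ q (l.map fun j => skolem C Tr m₀ j x) := by
  have : (l.map fun j => (skolemHist C Tr m₀ x (skolemIdx q l)).getD j m₀) =
      l.map fun j => skolem C Tr m₀ j x := by
    refine List.map_congr_left fun j hj => ?_
    rw [skolemHist_eq, List.getD_eq_getElem?_getD, List.getElem?_map,
      List.getElem?_range (lt_skolemIdx hj)]
    rfl
  rw [← this]
  simp [skolem, skolemStep, length_skolemHist, skolemIdx]

@[fun_prop]
theorem ArFun.decodeList {α : Type} [Primcodable α] {Y : Set ℕ} {f : α → ℕ} (hf : ArFun Y f) :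
    ArFun Y (fun a => (Encodable.decode (f a) : Option (List ℕ)).getD []) :=
  (ArFun.of_primrec (Primrec.option_getD.comp Primrec.decode (Primrec.const []))).comp hf

theorem arFun_clip (hC : Ar ∅ (fun m => m ∈ C)) : ArFun ∅ (clip C m₀) := by
  classical
  exact ArFun.ite hC (by fun_prop) (by fun_prop)

theorem arFun_coord (hC : Ar ∅ (fun m => m ∈ C)) :
    ArFun ∅ (fun p : List ℕ × ℕ => coord C m₀ p.1 p.2) :=
  (arFun_clip hC).comp (f := fun p : List ℕ × ℕ => p.1.getD p.2 m₀) (by fun_prop)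

theorem arFun_witness (hC : Ar ∅ (fun m => m ∈ C))
    (hTr : Ar ∅ (fun p : ℕ × List ℕ => Tr p.1 p.2)) :
    ArFun ∅ (fun p : ℕ × List ℕ => witness C Tr m₀ p.1 p.2) := by
  classical
  have h := ArFun.find (R := fun (p : ℕ × List ℕ) y => y ∈ C ∧ Tr p.1 (p.2 ++ [y])) ?_
    (ArFun.const (Y := ∅) m₀)
  · convert h using 2
    unfold witness
    congr!
  exact (hC.comp ArFun.snd).and (hTr.comp
    (f := fun p : (ℕ × List ℕ) × ℕ => (p.1.1, p.1.2 ++ [p.2])) (by fun_prop))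

theorem arFun_skolem (hC : Ar ∅ (fun m => m ∈ C))
    (hTr : Ar ∅ (fun p : ℕ × List ℕ => Tr p.1 p.2)) :
    ArFun ∅ (fun p : ℕ × List ℕ × List ℕ => skolem C Tr m₀ p.1 p.2) := by
  have hmap : ArFun ∅ (fun p : (List ℕ × List ℕ) × List ℕ =>
      ((Encodable.decode p.2.length.unpair.2.unpair.2 : Option (List ℕ)).getD []).map
        fun j => p.2.getD j m₀) :=
    ArFun.listMap (f := fun (p : (List ℕ × List ℕ) × List ℕ) j => p.2.getD j m₀)
      (by fun_prop) (by fun_prop)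
  have hstep : ArFun ∅ (fun p : (List ℕ × List ℕ) × List ℕ => skolemStep C Tr m₀ p.1 p.2) := by
    refine ArFun.ite (ArFun.eq (by fun_prop) (by fun_prop)) ((arFun_clip hC).comp (by fun_prop))
      (ArFun.ite (ArFun.eq (by fun_prop) (by fun_prop)) ?_
      (ArFun.ite (ArFun.eq (by fun_prop) (by fun_prop)) ?_ ?_))
    · exact (arFun_coord hC).comp (f := fun p : (List ℕ × List ℕ) × List ℕ =>
        (p.1.1, p.2.length.unpair.2)) (by fun_prop)
    · exact (arFun_coord hC).comp (f := fun p : (List ℕ × List ℕ) × List ℕ =>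
        (p.1.2, p.2.length.unpair.2)) (by fun_prop)
    · exact (arFun_witness hC hTr).comp (ArFun.prodMk (by fun_prop) hmap)
  have hhist : ArFun ∅ (fun p : (List ℕ × List ℕ) × ℕ => skolemHist C Tr m₀ p.1 p.2) := by
    refine ArFun.natRec (f := fun _ : List ℕ × List ℕ => ([] : List ℕ))
      (g := fun x _ s => s ++ [skolemStep C Tr m₀ x s]) (by fun_prop) (ArFun.append
      (by fun_prop) (ArFun.cons ?_ (by fun_prop)))
    exact hstep.comp (f := fun p : (List ℕ × List ℕ) × ℕ × List ℕ => (p.1, p.2.2))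
      (by fun_prop)
  exact hstep.comp (ArFun.prodMk (by fun_prop) (hhist.comp
    (f := fun p : ℕ × List ℕ × List ℕ => (p.2, p.1)) (by fun_prop)))

end Skolem

/-! ## Codes of formulas -/

attribute [instance] CodedStructure.struc

section Codes
variable (g : GoedelCoding L) {α β : Type}

theorem termCode_injective {enc : α → ℕ} (h : Function.Injective enc) :
    Function.Injective (termCode g enc : L.Term α → ℕ) := by
  intro s t hst
  refine Term.listEncode_injective (List.map_injective_iff.2 ?_ (Encodable.encode_injective hst))
  rintro (a | ⟨n, f⟩) (b | ⟨m, f'⟩) hab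
  · simp only [Sum.elim_inl, Nat.pair_eq_pair, true_and] at hab
    rw [h hab]
  · simp [Nat.pair_eq_pair] at hab
  · simp [Nat.pair_eq_pair] at hab
  · simp only [Sum.elim_inr, Nat.pair_eq_pair, true_and] at hab
    obtain ⟨rfl, hab⟩ := hab
    rw [g.encFun_inj _ hab]

theorem formulaCode_injective {enc : α → ℕ} (h : Function.Injective enc) (n : ℕ) :
    Function.Injective (formulaCode g enc : L.BoundedFormula α n → ℕ) := by
  intro φ ψ hφ
  have key := BoundedFormula.listEncode_sigma_injective (L := L) (α := α) (a₁ := ⟨n, φ⟩)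
    (a₂ := ⟨n, ψ⟩) (List.map_injective_iff.2 ?_ (Encodable.encode_injective hφ))
  · simpa using key
  have henc : ∀ k : ℕ, Function.Injective
      (Sum.elim (fun a => Nat.pair 0 (enc a)) (fun i => Nat.pair 1 i.1) : α ⊕ Fin k → ℕ) := by
    rintro k (a | i) (b | j) hab
    · simp only [Sum.elim_inl, Nat.pair_eq_pair, true_and] at hab
      rw [h hab]
    · simp [Nat.pair_eq_pair] at hab
    · simp [Nat.pair_eq_pair] at hab
    · simp only [Sum.elim_inr, Nat.pair_eq_pair, true_and] at hab
      rw [Fin.ext hab]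
  rintro (⟨k, t⟩ | ⟨k, R⟩ | m) (⟨k', t'⟩ | ⟨k', R'⟩ | m') hab <;>
    simp only [Sum.elim_inl, Sum.elim_inr, Nat.pair_eq_pair, true_and, zero_ne_one,
      OfNat.zero_ne_ofNat, OfNat.ofNat_ne_zero, one_ne_zero, false_and, OfNat.one_ne_ofNat,
      OfNat.ofNat_ne_one] at hab
  · obtain ⟨rfl, hab⟩ := hab
    rw [termCode_injective g (henc k) hab]
  · obtain ⟨rfl, hab⟩ := hab
    rw [g.encRel_inj _ hab]
  · rw [hab]

theorem tupleCode_injective {n : ℕ} : Function.Injective (tupleCode : (Fin n → ℕ) → ℕ) :=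
  fun _ _ h => List.ofFn_injective (Encodable.encode_injective h)

/-- Rename the free variables of a formula. -/
def rename (f : α → β) {n : ℕ} (φ : L.BoundedFormula α n) : L.BoundedFormula β n :=
  φ.mapTermRel (fun _ => Term.relabel (Sum.map f id)) (fun _ => id) (fun _ => id)

theorem realize_rename {M : Type*} [L.Structure M] (f : α → β) {n : ℕ}
    (φ : L.BoundedFormula α n) (v : β → M) (xs : Fin n → M) :
    (rename f φ).Realize v xs ↔ φ.Realize (v ∘ f) xs := by
  refine BoundedFormula.realize_mapTermRel_id (fun n t xs => ?_) (fun _ _ _ => rfl)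
  rw [Term.realize_relabel]
  congr 1
  ext (a | i) <;> rfl

theorem rename_rename {γ : Type} (f : α → β) (f' : β → γ) {n : ℕ} (φ : L.BoundedFormula α n) :
    rename f' (rename f φ) = rename (f' ∘ f) φ := by
  unfold rename
  induction φ with
  | falsum => rfl
  | equal => simp [BoundedFormula.mapTermRel, Sum.map_comp_map]
  | rel => simp [BoundedFormula.mapTermRel, Sum.map_comp_map]
  | imp _ _ ih₁ ih₂ => simp only [BoundedFormula.mapTermRel, ih₁, ih₂]
  | all _ ih => simp only [BoundedFormula.mapTermRel, ih, id]

theorem rename_id {n : ℕ} (φ : L.BoundedFormula α n) : rename id φ = φ := by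
  unfold rename
  induction φ with
  | falsum => rfl
  | equal => simp [BoundedFormula.mapTermRel]
  | rel => simp [BoundedFormula.mapTermRel]
  | imp _ _ ih₁ ih₂ => simp only [BoundedFormula.mapTermRel, ih₁, ih₂]
  | all _ ih => simp only [BoundedFormula.mapTermRel, ih, id]

theorem listEncode_relabel (f : α → β) (t : L.Term α) :
    (t.relabel f).listEncode = t.listEncode.map (Sum.map f id) := by
  induction t with
  | var => rfl
  | func F ts ih =>
    simp only [Term.relabel, Term.listEncode, List.map_cons, List.map_flatMap, ih]
    rfl

theorem listEncode_rename (f : α → β) {n : ℕ} (φ : L.BoundedFormula α n) :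
    (rename f φ).listEncode = φ.listEncode.map
      (Sum.map (fun p => ⟨p.1, p.2.relabel (Sum.map f id)⟩) id) := by
  unfold rename
  induction φ with
  | falsum => rfl
  | equal => rfl
  | rel => simp [BoundedFormula.mapTermRel, BoundedFormula.listEncode]
  | imp _ _ ih₁ ih₂ => simp [BoundedFormula.mapTermRel, BoundedFormula.listEncode, ih₁, ih₂]
  | all _ ih => simp [BoundedFormula.mapTermRel, BoundedFormula.listEncode, ih]

/-- Apply `v` to the code of a free variable in the code of a symbol of a term. -/
def mapTermSymbol (v : ℕ → ℕ) (s : ℕ) : ℕ :=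
  if s.unpair.1 = 0 then
    if s.unpair.2.unpair.1 = 0 then Nat.pair 0 (Nat.pair 0 (v s.unpair.2.unpair.2)) else s
  else s

/-- Apply `v` to the codes of the free variables in the code of a term. -/
def mapTermCode (v : ℕ → ℕ) (c : ℕ) : ℕ :=
  Encodable.encode (((Encodable.decode c : Option (List ℕ)).getD []).map (mapTermSymbol v))

/-- Apply `v` to the codes of the free variables in the code of a symbol of a formula. -/
def mapFormulaSymbol (v : ℕ → ℕ) (s : ℕ) : ℕ :=
  if s.unpair.1 = 0 then
    Nat.pair 0 (Nat.pair s.unpair.2.unpair.1 (mapTermCode v s.unpair.2.unpair.2))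
  else s

/-- Apply `v` to the codes of the free variables in the code of a formula. -/
def mapFormulaCode (v : ℕ → ℕ) (c : ℕ) : ℕ :=
  Encodable.encode (((Encodable.decode c : Option (List ℕ)).getD []).map (mapFormulaSymbol v))

theorem formulaCode_rename {enc : α → ℕ} {enc' : β → ℕ} {f : α → β} {v : ℕ → ℕ}
    (h : ∀ a, v (enc a) = enc' (f a)) {n : ℕ} (φ : L.BoundedFormula α n) :
    formulaCode g enc' (rename f φ) = mapFormulaCode v (formulaCode g enc φ) := by
  simp only [formulaCode, mapFormulaCode, listCode, listEncode_rename, Encodable.encodek,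
    Option.getD_some, List.map_map]
  congr 2
  ext (⟨k, t⟩ | ⟨k, R⟩ | m)
  · simp only [Function.comp, Sum.map_inl, Sum.elim_inl, mapFormulaSymbol, Nat.unpair_pair,
      if_true, mapTermCode, termCode, listCode, listEncode_relabel, Encodable.encodek,
      Option.getD_some, List.map_map]
    congr 4
    ext ((a | i) | F) <;> simp [mapTermSymbol, h]
  · simp [mapFormulaSymbol]
  · simp [mapFormulaSymbol]

theorem arFun_mapFormulaCode {γ : Type} [Primcodable γ] {v : γ → ℕ → ℕ}
    (hv : ArFun ∅ (fun p : γ × ℕ => v p.1 p.2)) :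
    ArFun ∅ (fun p : γ × ℕ => mapFormulaCode (v p.1) p.2) := by
  have h₁ : ArFun ∅ (fun p : γ × ℕ => mapTermSymbol (v p.1) p.2) := by
    refine ArFun.ite (ArFun.eq (by fun_prop) (by fun_prop)) (ArFun.ite (ArFun.eq (by fun_prop)
      (by fun_prop)) (ArFun.pair (by fun_prop) (ArFun.pair (by fun_prop) ?_)) (by fun_prop))
      (by fun_prop)
    exact hv.comp (f := fun p : γ × ℕ => (p.1, p.2.unpair.2.unpair.2)) (by fun_prop)
  have h₂ : ArFun ∅ (fun p : γ × ℕ => mapTermCode (v p.1) p.2) :=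
    ArFun.encode (ArFun.listMap (f := fun p : γ × ℕ => mapTermSymbol (v p.1))
      (h₁.comp (f := fun p : (γ × ℕ) × ℕ => (p.1.1, p.2)) (by fun_prop)) (by fun_prop))
  have h₃ : ArFun ∅ (fun p : γ × ℕ => mapFormulaSymbol (v p.1) p.2) := by
    refine ArFun.ite (ArFun.eq (by fun_prop) (by fun_prop)) (ArFun.pair (by fun_prop)
      (ArFun.pair (by fun_prop) ?_)) (by fun_prop)
    exact h₂.comp (f := fun p : γ × ℕ => (p.1, p.2.unpair.2.unpair.2)) (by fun_prop)
  exact ArFun.encode (ArFun.listMap (f := fun p : γ × ℕ => mapFormulaSymbol (v p.1))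
      (h₃.comp (f := fun p : (γ × ℕ) × ℕ => (p.1.1, p.2)) (by fun_prop)) (by fun_prop))

/-- The code in `Fin n ⊕ Fin k` of the variable with code `i` in `Fin (n + k)`. -/
def splitVar (n i : ℕ) : ℕ := if i < n then Nat.pair 0 i else Nat.pair 1 (i - n)

theorem splitVar_val {n k : ℕ} (i : Fin (n + k)) : splitVar n i =
    Sum.elim (fun i : Fin n => Nat.pair 0 i.1) (fun j : Fin k => Nat.pair 1 j.1)
      (finSumFinEquiv.symm i) := by
  refine Fin.addCases (fun i => ?_) (fun j => ?_) i <;> simp [splitVar]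

theorem arFun_splitVar : ArFun ∅ (fun p : ℕ × ℕ => splitVar p.1 p.2) :=
  ArFun.ite (ArFun.lt (by fun_prop) (by fun_prop)) (by fun_prop)
    (ArFun.pair (by fun_prop) (ArFun.of_primrec₂ Primrec.nat_sub (by fun_prop) (by fun_prop)))

end Codes

/-! ## Truth predicates of coded structures -/

section Truth
variable (g : GoedelCoding L) (M : CodedStructure L)

/-- The tuple `l` satisfies the formula coded by `q`. -/
def Sat (q : ℕ) (l : List ℕ) : Prop := Nat.pair q (Encodable.encode l) ∈ elemDiagram g M

variable {M}

theorem sat_iff {q : ℕ} {l : List ℕ} : Sat g M q l ↔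
    ∃ (k : ℕ) (φ : L.Formula (Fin k)) (a : Fin k → M.carrier),
      q = Nat.pair k (formulaCode g Fin.val φ) ∧ l = List.ofFn (fun i => (a i : ℕ)) ∧
        φ.Realize a := by
  refine exists_congr fun k => exists_congr fun φ => exists_congr fun a => ?_
  rw [Nat.pair_eq_pair, and_assoc]
  refine and_congr_right fun _ => and_congr_left fun _ => ?_
  exact Encodable.encode_injective.eq_iff

theorem sat_ofFn {k : ℕ} {φ : L.Formula (Fin k)} {a : Fin k → M.carrier} :
    Sat g M (Nat.pair k (formulaCode g Fin.val φ)) (List.ofFn fun i => (a i : ℕ)) ↔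
      φ.Realize a := by
  rw [sat_iff]
  constructor
  · rintro ⟨k', φ', a', hq, hl, h⟩
    obtain ⟨rfl, hφ⟩ := Nat.pair_eq_pair.1 hq
    obtain rfl := formulaCode_injective g Fin.val_injective 0 hφ
    obtain rfl : a = a' := funext fun i => Subtype.ext (congrFun (List.ofFn_injective hl) i)
    exact h
  · exact fun h => ⟨k, φ, a, rfl, rfl, h⟩

theorem ArithDecidable.ar_sat (h : ArithDecidable g M) :
    Ar ∅ (fun p : ℕ × List ℕ => Sat g M p.1 p.2) :=
  (arReducible_iff.1 h).comp (f := fun p : ℕ × List ℕ => Nat.pair p.1 (Encodable.encode p.2))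
    (by fun_prop)

theorem ArithDecidable.ar_carrier (h : ArithDecidable g M) : Ar ∅ (fun m => m ∈ M.carrier) := by
  refine ((h.ar_sat g).comp (f := fun m : ℕ => (Nat.pair 1 (formulaCode g Fin.val
    (⊤ : L.Formula (Fin 1))), [m])) (by fun_prop)).of_iff fun m => ?_
  rw [sat_iff]
  constructor
  · rintro ⟨k, φ, a, hq, hl, -⟩
    dsimp only at hq
    obtain ⟨rfl, -⟩ := Nat.pair_eq_pair.1 hq
    have : m = a 0 := by simpa using hl
    exact this ▸ (a 0).2
  · exact fun hm => ⟨1, ⊤, fun _ => ⟨m, hm⟩, rfl, by simp, Formula.realize_top.2 trivial⟩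

variable (M)

/-- The tuple `l` of length `n` satisfies the formula with parameters coded by `c`. -/
def ParamSat (n c : ℕ) (l : List ℕ) : Prop :=
  ∃ (e : ℕ) (r : List ℕ),
    c = Nat.pair (Nat.pair r.length (mapFormulaCode (splitVar n) e)) (Encodable.encode r) ∧
      Sat g M (Nat.pair (n + r.length) e) (l ++ r)

variable {M}

theorem ArithDecidable.ar_paramSat (h : ArithDecidable g M) :
    Ar ∅ (fun p : (ℕ × ℕ) × List ℕ => ParamSat g M p.1.1 p.1.2 p.2) := by
  refine Ar.ex (Ar.ex (Ar.and (ArFun.eq (by fun_prop) (ArFun.pair (ArFun.pair (by fun_prop)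
    ((arFun_mapFormulaCode arFun_splitVar).comp
      (f := fun p : (((ℕ × ℕ) × List ℕ) × ℕ) × List ℕ => (p.1.1.1.1, p.1.2)) (by fun_prop)))
      (by fun_prop))) ((h.ar_sat g).comp
      (f := fun p : (((ℕ × ℕ) × List ℕ) × ℕ) × List ℕ =>
        (Nat.pair (p.1.1.1.1 + p.2.length) p.1.2, p.1.1.2 ++ p.2)) (by fun_prop))))

theorem paramSat_iff {n c : ℕ} {b : Fin n → M.carrier} :
    ParamSat g M n c (List.ofFn fun i => (b i : ℕ)) ↔
      ∃ (k : ℕ) (φ : L.Formula (Fin n ⊕ Fin k)) (a : Fin k → M.carrier),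
        c = Nat.pair (Nat.pair k (formulaCode g
          (Sum.elim (fun i : Fin n => Nat.pair 0 i.1) (fun j : Fin k => Nat.pair 1 j.1)) φ))
          (tupleCode fun i => (a i : ℕ)) ∧ φ.Realize (Sum.elim b a) := by
  have key : ∀ (k : ℕ) (a : Fin k → M.carrier),
      Sum.elim b a ∘ finSumFinEquiv.symm = Fin.append b a := by
    intro k a
    ext i
    refine Fin.addCases (fun i => ?_) (fun j => ?_) i <;> simp
  have key' : ∀ (k : ℕ) (a : Fin k → M.carrier),
      (List.ofFn fun i => ((Fin.append b a i : M.carrier) : ℕ)) =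
      (List.ofFn fun i => (b i : ℕ)) ++ List.ofFn fun i => (a i : ℕ) := by
    intro k a
    rw [← List.ofFn_fin_append]
    congr 1
    ext i
    refine Fin.addCases (fun i => ?_) (fun j => ?_) i <;> simp
  constructor
  · rintro ⟨e, r, rfl, h⟩
    obtain ⟨k', ψ, d, hq, hl, hr⟩ := (sat_iff g).1 h
    obtain ⟨rfl, rfl⟩ := Nat.pair_eq_pair.1 hq
    have hd : d = Fin.append (fun i => d (Fin.castAdd _ i)) (fun i => d (Fin.natAdd _ i)) := by
      ext i
      refine Fin.addCases (fun i => ?_) (fun j => ?_) i <;> simp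
    have hl' : (List.ofFn fun i => (b i : ℕ)) ++ r =
        (List.ofFn fun i => (d (Fin.castAdd _ i) : ℕ)) ++
          List.ofFn fun i => (d (Fin.natAdd _ i) : ℕ) := by
      rw [hl, ← List.ofFn_fin_append]
      congr 1
      ext i
      refine Fin.addCases (fun i => ?_) (fun j => ?_) i <;> simp
    obtain ⟨h₁, h₂⟩ := List.append_inj hl' (by simp)
    have hb : b = fun i => d (Fin.castAdd _ i) :=
      funext fun i => Subtype.ext (congrFun (List.ofFn_injective h₁) i)
    refine ⟨r.length, rename finSumFinEquiv.symm ψ, fun i => d (Fin.natAdd _ i), ?_, ?_⟩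
    · rw [formulaCode_rename g (enc := Fin.val) (v := splitVar n) splitVar_val, tupleCode,
        listCode, ← h₂]
    · refine (realize_rename _ _ _ _).2 ?_
      rw [key, hb, ← hd]
      exact hr
  · rintro ⟨k, φ, a, rfl, h⟩
    refine ⟨formulaCode g Fin.val (rename finSumFinEquiv φ),
      List.ofFn fun i => (a i : ℕ), ?_, ?_⟩
    · rw [← formulaCode_rename g (enc := Fin.val) (v := splitVar n) (f := finSumFinEquiv.symm)
        (enc' := Sum.elim (fun i : Fin n => Nat.pair 0 i.1) (fun j : Fin k => Nat.pair 1 j.1))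
        splitVar_val, rename_rename]
      simp [rename_id, tupleCode, listCode]
    · rw [← key', List.length_ofFn, sat_ofFn, ← key]
      refine (realize_rename _ _ _ _).2 ?_
      rw [Function.comp_assoc, Equiv.symm_comp_self]
      exact h

theorem paramSat_pfCode {N : CodedStructure L} (h : M.carrier ⊆ N.carrier) {n : ℕ}
    (b : Fin n → N.carrier) (q : ParamFormula L M n) :
    ParamSat g N n (pfCode g q) (List.ofFn fun i => (b i : ℕ)) ↔
      q.2.1.Realize (Sum.elim b (fun i => (⟨q.2.2 i, h (q.2.2 i).2⟩ : N.carrier))) := by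
  rw [paramSat_iff]
  constructor
  · rintro ⟨k, φ, a, hc, hr⟩
    obtain ⟨k', ψ, d⟩ := q
    obtain ⟨hc, ha⟩ := Nat.pair_eq_pair.1 hc
    obtain ⟨rfl, hc⟩ := Nat.pair_eq_pair.1 hc
    have hinj : Function.Injective (Sum.elim (fun i : Fin n => Nat.pair 0 i.1)
        (fun j : Fin k' => Nat.pair 1 j.1)) := by
      rintro (i | i) (j | j) hij <;>
        simp [Nat.pair_eq_pair] at hij <;> rw [Fin.ext hij]
    obtain rfl := formulaCode_injective g hinj 0 hc
    have hd : a = fun i => ⟨d i, h (d i).2⟩ :=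
      funext fun i => Subtype.ext (congrFun (tupleCode_injective ha) i).symm
    rw [hd] at hr
    exact hr
  · exact fun hr => ⟨q.1, q.2.1, _, rfl, hr⟩

end Truth

/-! ## Finite satisfiability of the requirements -/

/-- Few requirements `ρ (idx t) ≠ f t ρ`, in which `f t` does not depend on the coordinate
`idx t`, can be met simultaneously in a cube over a large set. -/
theorem exists_avoiding {ι B X T : Type} [Finite ι] [Fintype B] (s : Finset T)
    (hs : s.card < Fintype.card B) (idx : T → ι) (v : B → X) (hv : Function.Injective v)
    (f : T → (ι → B) → X)
    (hf : ∀ t ∈ s, ∀ ρ ρ' : ι → B, (∀ j, j ≠ idx t → ρ j = ρ' j) → f t ρ = f t ρ') :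
    ∃ ρ : ι → B, ∀ t ∈ s, v (ρ (idx t)) ≠ f t ρ := by
  classical
  have := Fintype.ofFinite ι
  by_contra! h
  let bad : T → Finset (ι → B) := fun t => {ρ | v (ρ (idx t)) = f t ρ}
  have hbad : ∀ t ∈ s, (bad t).card * Fintype.card B ≤ Fintype.card (ι → B) := by
    intro t ht
    rw [← Finset.card_univ (α := B), ← Finset.card_product, ← Finset.card_univ]
    refine Finset.card_le_card_of_injOn (fun p => Function.update p.1 (idx t) p.2)
      (fun _ _ => Finset.mem_coe.2 (Finset.mem_univ _)) ?_
    rintro ⟨ρ, b⟩ hρ ⟨ρ', b'⟩ hρ' hup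
    have hρ : v (ρ (idx t)) = f t ρ := by simpa [bad] using hρ
    have hρ' : v (ρ' (idx t)) = f t ρ' := by simpa [bad] using hρ'
    have hoff : ∀ j, j ≠ idx t → ρ j = ρ' j := by
      intro j hj
      simpa [hj] using congrFun hup j
    have hb : b = b' := by simpa using congrFun hup (idx t)
    have hon : ρ (idx t) = ρ' (idx t) := hv (by rw [hρ, hρ', hf t ht ρ ρ' hoff])
    have : ρ = ρ' := by
      funext j
      by_cases hj : j = idx t
      · rw [hj, hon]
      · exact hoff j hj
    rw [this, hb]
  have hcover : Fintype.card (ι → B) ≤ ∑ t ∈ s, (bad t).card := by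
    rw [← Finset.card_univ]
    refine (Finset.card_le_card fun ρ _ => ?_).trans Finset.card_biUnion_le
    obtain ⟨t, ht, h⟩ := h ρ
    exact Finset.mem_biUnion.2 ⟨t, ht, by simpa [bad] using h⟩
  have hpos : 0 < Fintype.card (ι → B) := by
    have : Nonempty B := Fintype.card_pos_iff.1 (by omega)
    exact Fintype.card_pos
  have h₁ : Fintype.card (ι → B) * Fintype.card B ≤ s.card * Fintype.card (ι → B) := by
    refine (Nat.mul_le_mul_right _ hcover).trans ?_
    rw [Finset.sum_mul, ← smul_eq_mul]
    exact Finset.sum_le_card_nsmul _ _ _ hbad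
  rw [mul_comm] at h₁
  exact absurd (Nat.le_of_mul_le_mul_right h₁ hpos) (by omega)

section Requirements
variable {C : Set ℕ} {m₀ : ℕ}

theorem coord_mem (h : m₀ ∈ C) (l : List ℕ) (i : ℕ) : coord C m₀ l i ∈ C := clip_mem h _

theorem coord_ofFn {n : ℕ} {v : Fin n → ℕ} (hv : ∀ i, v i ∈ C) (i : Fin n) :
    coord C m₀ (List.ofFn v) i = v i := by
  simp [coord, clip_of_mem, hv]

theorem coord_ofFn_of_le {n : ℕ} (v : Fin n → ℕ) {i : ℕ} (h : n ≤ i) (hm : m₀ ∈ C) :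
    coord C m₀ (List.ofFn v) i = m₀ := by
  rw [coord, List.getD_eq_default _ _ (by simpa using h), clip_of_mem hm]

/-- The values of the function `f` do not depend on the coordinate `i` of its argument. -/
def IndepOf (C : Set ℕ) (m₀ : ℕ) (f : List ℕ × List ℕ → ℕ) (i : ℕ) : Prop :=
  ∀ l a a' : List ℕ, (∀ j, j ≠ i → coord C m₀ a j = coord C m₀ a' j) → f (l, a) = f (l, a')

theorem exists_coord_ne (hC : C.Infinite) (hm : m₀ ∈ C) (f : ℕ → List ℕ × List ℕ → ℕ)
    (l : List ℕ) (k : ℕ) : ∃ a : List ℕ, ∀ n < k, IndepOf C m₀ (f n.unpair.2) n.unpair.1 →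
      coord C m₀ a n.unpair.1 ≠ f n.unpair.2 (l, a) := by
  classical
  obtain ⟨B, hB, hcard⟩ := hC.exists_subset_card_eq (k + 2)
  let s : Finset ℕ := {n ∈ Finset.range (k + 1) | IndepOf C m₀ (f n.unpair.2) n.unpair.1}
  have hs : s.card < Fintype.card B := by
    have := Finset.card_filter_le (Finset.range (k + 1))
      (fun n => IndepOf C m₀ (f n.unpair.2) n.unpair.1)
    rw [Finset.card_range] at this
    rw [Fintype.card_coe, hcard]
    exact this.trans_lt (by omega)
  have hC' : ∀ (ρ : Fin (k + 1) → B) (i), (ρ i : ℕ) ∈ C := fun ρ i => hB (ρ i).2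
  have hf : ∀ n ∈ s, ∀ ρ ρ' : Fin (k + 1) → B,
      (∀ j, j ≠ Fin.ofNat (k + 1) n.unpair.1 → ρ j = ρ' j) →
      f n.unpair.2 (l, List.ofFn fun i => (ρ i : ℕ)) =
        f n.unpair.2 (l, List.ofFn fun i => (ρ' i : ℕ)) := by
    intro n hn ρ ρ' hoff
    simp only [s, Finset.mem_filter, Finset.mem_range] at hn
    refine hn.2 _ _ _ fun j hj => ?_
    by_cases hjk : j < k + 1
    · rw [coord_ofFn (hC' ρ) ⟨j, hjk⟩, coord_ofFn (hC' ρ') ⟨j, hjk⟩, hoff]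
      have h₂ : n.unpair.1 < k + 1 := (Nat.unpair_left_le n).trans_lt (by omega)
      intro h
      have := congrArg Fin.val h
      simp [Nat.mod_eq_of_lt h₂] at this
      exact hj this
    · rw [coord_ofFn_of_le _ (by omega) hm, coord_ofFn_of_le _ (by omega) hm]
  obtain ⟨ρ, hρ⟩ := exists_avoiding s hs (fun n => Fin.ofNat (k + 1) n.unpair.1)
    (Subtype.val) Subtype.val_injective
    (fun n (ρ : Fin (k + 1) → B) => f n.unpair.2 (l, List.ofFn fun i => (ρ i : ℕ))) hf
  refine ⟨List.ofFn fun i => (ρ i : ℕ), fun n hn hind => ?_⟩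
  have h₁ := hρ n (by simp [s, hind]; omega)
  have h₂ : n.unpair.1 < k + 1 := (Nat.unpair_left_le n).trans_lt (by omega)
  have h₃ : Fin.ofNat (k + 1) n.unpair.1 = ⟨n.unpair.1, h₂⟩ := by
    simp [Fin.ext_iff, Nat.mod_eq_of_lt h₂]
  rw [h₃] at h₁
  rw [coord_ofFn (hC' ρ) ⟨n.unpair.1, h₂⟩]
  exact h₁

theorem TypeConsistent.exists_realize (g : GoedelCoding L) {M : CodedStructure L} {n : ℕ}
    {p : Set (ParamFormula L M n)} (hp : TypeConsistent M p) (k : ℕ) :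
    ∃ b : Fin n → M.carrier, ∀ c < k, c ∈ typeCode g p →
      ParamSat g M n c (List.ofFn fun i => (b i : ℕ)) := by
  obtain ⟨N, SN, j, b, hb⟩ := hp
  let J := {c : Fin k // (c : ℕ) ∈ typeCode g p}
  choose q hq hc using fun c : J => c.2
  let θ : J → L.Formula (M.carrier ⊕ Fin n) := fun c =>
    rename (Sum.elim Sum.inr (Sum.inl ∘ (q c).2.2)) (q c).2.1
  have hθ : ∀ (K : Type) (_ : L.Structure K) (v : M.carrier → K) (d : Fin n → K) (c : J),
      (θ c).Realize (Sum.elim v d) ↔ (q c).2.1.Realize (Sum.elim d (v ∘ (q c).2.2)) := by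
    intro K _ v d c
    refine (realize_rename _ _ _ _).trans ?_
    rw [Sum.comp_elim]
    rfl
  have h₁ : ((Formula.iInf θ).iExs (Fin n)).Realize (fun m => EEmb.fn j m) := by
    rw [Formula.realize_iExs]
    refine ⟨b, ?_⟩
    rw [Formula.realize_iInf]
    exact fun c => (hθ N SN _ b c).2 (hb _ (hq c))
  have h₂ : ((Formula.iInf θ).iExs (Fin n)).Realize (id : M.carrier → M.carrier) :=
    (ElementaryEmbedding.map_formula (M := M.carrier) (N := N) j _ _).1 h₁
  rw [Formula.realize_iExs] at h₂
  obtain ⟨d, hd⟩ := h₂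
  rw [Formula.realize_iInf] at hd
  refine ⟨d, fun c hck hcp => ?_⟩
  have := (hθ M.carrier M.struc _ d ⟨⟨c, hck⟩, hcp⟩).1 (hd _)
  rw [show c = _ from hc ⟨⟨c, hck⟩, hcp⟩]
  exact (paramSat_pfCode g (Set.Subset.refl _) d _).2 this

end Requirements

/-! ## Elementary submodels of ultrapowers as coded structures -/

section Models
variable {M : CodedStructure L} {I : Type} {F : ℕ → I → M.carrier}

/-- The functions `F e`, for `e ∈ G`, are closed under Skolem functions. -/
def SkolemClosed (F : ℕ → I → M.carrier) (G : Set ℕ) : Prop :=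
  ∀ (k : ℕ) (φ : L.Formula (Fin (k + 1))) (e : Fin k → ℕ), (∀ i, e i ∈ G) →
    ∃ e' ∈ G, ∀ (x : I) (y : M.carrier),
      φ.Realize (Fin.snoc (fun i => F (e i) x) y : Fin (k + 1) → M.carrier) →
      φ.Realize (Fin.snoc (fun i => F (e i) x) (F e' x) : Fin (k + 1) → M.carrier)

/-- The class of `F e` in the ultrapower. -/
def cls (F : ℕ → I → M.carrier) (U : Ultrafilter I) (e : ℕ) :
    (U : Filter I).Product fun _ => M.carrier := ((F e : I → M.carrier) :)

theorem cls_eq_iff {U : Ultrafilter I} {e e' : ℕ} :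
    cls F U e = cls F U e' ↔ ∀ᶠ x in (U : Filter I), F e x = F e' x :=
  Quotient.eq''

variable [Nonempty M.carrier] {G : Set ℕ}

theorem realize_cls {U : Ultrafilter I} {α : Type} (φ : L.Formula α) (e : α → ℕ) :
    φ.Realize (fun i => cls F U (e i)) ↔
      ∀ᶠ x in (U : Filter I), φ.Realize fun i => F (e i) x :=
  Ultraproduct.realize_formula_cast φ fun i => F (e i)

theorem SkolemClosed.exists_cls (hG : SkolemClosed F G) (U : Ultrafilter I) {k : ℕ}
    (φ : L.Formula (Fin (k + 1))) {e : Fin k → ℕ} (he : ∀ i, e i ∈ G)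
    (a : (U : Filter I).Product fun _ => M.carrier)
    (h : φ.Realize (Fin.snoc (fun i => cls F U (e i)) a : Fin (k + 1) → _)) :
    ∃ e' ∈ G, φ.Realize (Fin.snoc (fun i => cls F U (e i)) (cls F U e') : Fin (k + 1) → _) := by
  obtain ⟨e', he', H⟩ := hG k φ e he
  refine ⟨e', he', ?_⟩
  induction a using Quotient.inductionOn' with
  | h a =>
  have key : ∀ b : I → M.carrier,
      φ.Realize (Fin.snoc (fun i => cls F U (e i))
        ((b : I → M.carrier) : (U : Filter I).Product fun _ => M.carrier) : Fin (k + 1) → _) ↔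
      ∀ᶠ x in (U : Filter I), φ.Realize
        (Fin.snoc (fun i => F (e i) x) (b x) : Fin (k + 1) → M.carrier) := by
    intro b
    have h₁ := Ultraproduct.realize_formula_cast (u := U) φ
      (Fin.snoc (fun i => F (e i)) b : Fin (k + 1) → I → M.carrier)
    have h₂ : (fun i => ((Fin.snoc (fun i => F (e i)) b : Fin (k + 1) → I → M.carrier) i :
        (U : Filter I).Product fun _ => M.carrier)) = Fin.snoc (fun i => cls F U (e i))
        ((b : I → M.carrier) : (U : Filter I).Product fun _ => M.carrier) := by
      funext i
      refine Fin.lastCases ?_ (fun i => ?_) i <;> simp [cls]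
    have h₃ : ∀ x, (fun i => (Fin.snoc (fun i => F (e i)) b : Fin (k + 1) → I → M.carrier) i x) =
        (Fin.snoc (fun i => F (e i) x) (b x) : Fin (k + 1) → M.carrier) := by
      intro x
      funext i
      refine Fin.lastCases ?_ (fun i => ?_) i <;> simp
    rw [h₂] at h₁
    simp only [h₃] at h₁
    exact h₁
  exact (key (F e')).2 (((key a).1 h).mono fun x hx => H x _ hx)

/-- The elementary submodel of the ultrapower given by a set of indices. -/
def SkolemClosed.substructure (hG : SkolemClosed F G) (U : Ultrafilter I) :
    L.Substructure ((U : Filter I).Product fun _ => M.carrier) where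
  carrier := cls F U '' G
  fun_mem := by
    intro k f x hx
    choose e he hx using hx
    obtain rfl : (fun i => cls F U (e i)) = x := funext hx
    obtain ⟨e', he', h⟩ := hG.exists_cls U
      (Term.equal (Term.func f fun i => Term.var i.castSucc) (Term.var (Fin.last k))) he
      (Structure.funMap f fun i => cls F U (e i)) (by simp [Formula.realize_equal])
    refine ⟨e', he', ?_⟩
    simpa [Formula.realize_equal, eq_comm] using h

theorem SkolemClosed.isElementary (hG : SkolemClosed F G) (U : Ultrafilter I) :
    (hG.substructure U).IsElementary := by
  refine Substructure.isElementary_of_exists _ fun n φ x a h => ?_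
  choose e he hx using fun i => (x i).2
  have hx : (Subtype.val ∘ x) = fun i => cls F U (e i) := funext fun i => (hx i).symm
  let ψ : L.Formula (Fin (n + 1)) := rename (Sum.elim Empty.elim id) φ.toFormula
  have hψ : ∀ w : Fin (n + 1) → ((U : Filter I).Product fun _ => M.carrier),
      ψ.Realize w ↔ φ.Realize default w := by
    intro w
    refine (realize_rename _ _ _ _).trans ((BoundedFormula.realize_toFormula _ _).trans ?_)
    rw [Subsingleton.elim (_ ∘ Sum.inl) default]
    rfl
  rw [hx] at h ⊢
  obtain ⟨e', he', h'⟩ := hG.exists_cls U ψ he a ((hψ _).2 h)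
  exact ⟨⟨_, e', he', rfl⟩, (hψ _).1 h'⟩

/-- An elementary submodel of the ultrapower, with elements named by `κ`. -/
theorem SkolemClosed.exists_model (hG : SkolemClosed F G) {U : Ultrafilter I} {κ : ℕ → ℕ}
    (hκ : ∀ e e', κ e = κ e' ↔ ∀ᶠ x in (U : Filter I), F e x = F e' x)
    (hinf : (Set.range κ)ᶜ.Infinite) :
    ∃ N : CodedStructure L, N.carrier = κ '' G ∧
      ∀ (k : ℕ) (φ : L.Formula (Fin k)) (a : Fin k → N.carrier) (e : Fin k → ℕ),
        (∀ i, e i ∈ G) → (∀ i, (a i : ℕ) = κ (e i)) →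
        (φ.Realize a ↔ ∀ᶠ x in (U : Filter I), φ.Realize fun i => F (e i) x) := by
  let S := hG.substructure U
  have hbij : ∃ f : S ≃ ↥(κ '' G), ∀ (e : ℕ) (he : e ∈ G),
      f ⟨cls F U e, e, he, rfl⟩ = ⟨κ e, e, he, rfl⟩ := by
    choose r hr hr' using fun s : S => s.2
    refine ⟨Equiv.ofBijective (fun s => ⟨κ (r s), r s, hr s, rfl⟩) ⟨fun s t h => ?_, ?_⟩, ?_⟩
    · have h := congrArg Subtype.val h
      refine Subtype.ext ?_
      rw [← hr' s, ← hr' t]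
      exact cls_eq_iff.2 ((hκ _ _).1 h)
    · rintro ⟨_, e, he, rfl⟩
      exact ⟨⟨cls F U e, e, he, rfl⟩, Subtype.ext ((hκ _ _).2 (cls_eq_iff.1 (hr' _)))⟩
    · exact fun e he => Subtype.ext ((hκ _ _).2 (cls_eq_iff.1 (hr' ⟨cls F U e, e, he, rfl⟩)))
  obtain ⟨f, hf⟩ := hbij
  refine ⟨⟨κ '' G, hinf.mono (Set.compl_subset_compl.2 (Set.image_subset_range _ _)),
    f.inducedStructure⟩, rfl, fun k φ a e he ha => ?_⟩
  let := f.inducedStructure (L := L)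
  have h₁ : a = f.inducedStructureEquiv (L := L) ∘
      (fun i => (⟨cls F U (e i), e i, he i, rfl⟩ : S)) := by
    funext i
    exact Subtype.ext ((ha i).trans (congrArg Subtype.val (hf (e i) (he i)).symm))
  rw [← realize_cls, h₁]
  refine (StrongHomClass.realize_formula (f.inducedStructureEquiv (L := L)) φ).trans ?_
  exact ((ElementarySubstructure.subtype ⟨_, hG.isElementary U⟩).map_formula φ
    (fun i => (⟨cls F U (e i), e i, he i, rfl⟩ : S))).symm

end Models

/-! ## Naming the elements of a quotient -/

theorem arFun_count {C : Set ℕ} [DecidablePred (· ∉ C)] (hC : Ar ∅ (fun m => m ∈ C)) :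
    ArFun ∅ (fun n => Nat.count (· ∉ C) n) := by
  have h := (ArFun.natRec (Y := ∅) (f := fun _ : Unit => (0 : ℕ))
    (g := fun _ n s => s + if n ∉ C then 1 else 0) (by fun_prop)
    (ArFun.add (by fun_prop) (ArFun.ite (hC.comp
      (f := fun p : Unit × ℕ × ℕ => p.2.1) (by fun_prop)).not (by fun_prop) (by fun_prop)))).comp
    (f := fun e : ℕ => ((), e)) (by fun_prop)
  refine (funext fun n => ?_ : _ = fun n => Nat.count (· ∉ C) n) ▸ h
  induction n with
  | zero => rfl
  | succ n ih => rw [Nat.count_succ, ← ih]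

theorem arFun_nth {C : Set ℕ} (hC : Ar ∅ (fun m => m ∈ C)) (hinf : Cᶜ.Infinite) :
    ArFun ∅ (fun n => Nat.nth (· ∉ C) n) := by
  classical
  refine ArFun.of_graph (R := fun n m => m ∉ C ∧ Nat.count (· ∉ C) m = n) ?_ fun n m => ?_
  · exact (hC.comp (f := fun p : ℕ × ℕ => p.2) (by fun_prop)).not.and
      (ArFun.eq ((arFun_count hC).comp (by fun_prop)) (by fun_prop))
  · constructor
    · rintro ⟨hm, rfl⟩
      exact Nat.nth_count hm
    · rintro rfl
      exact ⟨Nat.nth_mem_of_infinite hinf n, Nat.count_nth_of_infinite hinf n⟩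

/-- Names for the classes of an arithmetical equivalence relation, extending given names. -/
theorem exists_naming {E : ℕ → ℕ → Prop} (hE : Equivalence E)
    (hEar : Ar ∅ (fun p : ℕ × ℕ => E p.1 p.2))
    {C : Set ℕ} (hC : Ar ∅ (fun m => m ∈ C)) (hinf : Cᶜ.Infinite) {c : ℕ → ℕ}
    (hc : ArFun ∅ c) (hcC : ∀ m ∈ C, ∀ m' ∈ C, E (c m) (c m') → m = m') :
    ∃ κ : ℕ → ℕ, ArFun ∅ κ ∧ (∀ e e', κ e = κ e' ↔ E e e') ∧ (∀ m ∈ C, κ (c m) = m) ∧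
      (Set.range κ)ᶜ.Infinite := by
  classical
  let R : ℕ → ℕ → Prop := fun e r =>
    (∃ m, m ∈ C ∧ E e (c m)) ∧ (r ∈ C ∧ E e (c r)) ∨
    (¬ ∃ m, m ∈ C ∧ E e (c m)) ∧
      ∃ e', (E e e' ∧ ∀ e'' < e', ¬ E e e'') ∧ r = Nat.nth (· ∉ C) (e' + e')
  have hR : ∀ e, ∃! r, R e r := by
    intro e
    by_cases h : ∃ m, m ∈ C ∧ E e (c m)
    · obtain ⟨m, hm, hem⟩ := h
      refine ⟨m, Or.inl ⟨⟨m, hm, hem⟩, hm, hem⟩, ?_⟩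
      rintro r (⟨-, hr, her⟩ | ⟨h, -⟩)
      · exact hcC r hr m hm (hE.trans (hE.symm her) hem)
      · exact absurd ⟨m, hm, hem⟩ h
    · have h' : ∃ e', E e e' := ⟨e, hE.refl e⟩
      refine ⟨_, Or.inr ⟨h, _, ⟨Nat.find_spec h', fun e'' => Nat.find_min h'⟩, rfl⟩, ?_⟩
      rintro r (⟨h₁, -⟩ | ⟨-, e', ⟨h₁, h₂⟩, rfl⟩)
      · exact absurd h₁ h
      · rw [(Nat.find_eq_iff h').2 ⟨h₁, h₂⟩]
  choose κ hκ hκ' using hR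
  have hRE : ∀ {e e' r}, E e e' → R e r → R e' r := by
    intro e e' r h
    have : ∀ d, E e d ↔ E e' d := fun d =>
      ⟨fun h' => hE.trans (hE.symm h) h', fun h' => hE.trans h h'⟩
    simp only [R, this, imp_self]
  have hnth : ∀ i, Nat.nth (· ∉ C) i ∉ C := Nat.nth_mem_of_infinite hinf
  have hinj := Nat.nth_injective hinf
  refine ⟨κ, ?_, fun e e' => ⟨fun h => ?_, fun h => hκ' _ _ (hRE h (hκ e))⟩, fun m hm => ?_, ?_⟩
  · refine ArFun.of_graph (R := R) ?_ fun e r => ⟨fun h => (hκ' e r h).symm, ?_⟩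
    · have h₁ : Ar ∅ (fun p : ℕ × ℕ => p.2 ∈ C ∧ E p.1 (c p.2)) :=
        (hC.comp (f := fun p : ℕ × ℕ => p.2) (by fun_prop)).and
          (hEar.comp (f := fun p : ℕ × ℕ => (p.1, c p.2)) (by fun_prop))
      have h₂ : Ar ∅ (fun p : ℕ × ℕ => ∃ m, m ∈ C ∧ E p.1 (c m)) :=
        Ar.ex (h₁.comp (f := fun p : (ℕ × ℕ) × ℕ => (p.1.1, p.2)) (by fun_prop))
      have h₃ : Ar ∅ (fun p : ℕ × ℕ => ∃ e', (E p.1 e' ∧ ∀ e'', e'' < e' → ¬ E p.1 e'') ∧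
          p.2 = Nat.nth (· ∉ C) (e' + e')) := by
        refine Ar.ex (((hEar.comp (f := fun p : (ℕ × ℕ) × ℕ => (p.1.1, p.2)) (by fun_prop)).and
          (Ar.all ((ArFun.lt ?_ ?_).imp (hEar.comp
            (f := fun p : ((ℕ × ℕ) × ℕ) × ℕ => (p.1.1.1, p.2)) (by fun_prop)).not))).and
          (ArFun.eq ?_ ((arFun_nth hC hinf).comp (f := fun p : (ℕ × ℕ) × ℕ => p.2 + p.2) ?_)))
          <;> fun_prop
      exact (h₂.and h₁).or (h₂.not.and h₃)
    · rintro rfl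
      exact hκ e
  · have h₁ := hκ e
    have h₂ := hκ e'
    rw [← h] at h₂
    rcases h₁ with ⟨-, hr, h₁⟩ | ⟨h₁, d, ⟨hd, -⟩, hr⟩ <;>
      rcases h₂ with ⟨-, hr', h₂⟩ | ⟨h₂, d', ⟨hd', -⟩, hr'⟩
    · exact hE.trans h₁ (hE.symm h₂)
    · exact absurd (hr' ▸ hr) (hnth _)
    · exact absurd (hr ▸ hr') (hnth _)
    · have : d = d' := by have := hinj (hr.symm.trans hr'); omega
      exact hE.trans hd (this ▸ hE.symm hd')
  · exact (hκ' _ _ (Or.inl ⟨⟨m, hm, hE.refl _⟩, hm, hE.refl _⟩)).symm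
  · refine Set.infinite_of_injective_forall_mem
      (f := fun i => Nat.nth (· ∉ C) (2 * i + 1)) (fun i j h => ?_) ?_
    · have := hinj h
      omega
    · rintro i ⟨e, he⟩
      have h := hκ e
      rw [he] at h
      rcases h with ⟨-, h, -⟩ | ⟨-, d, -, h⟩
      · exact hnth _ h
      · have := hinj h
        omega

/-! ## Realizing a type in an elementary extension of a given degree -/

section Extension
variable (g : GoedelCoding L) {M : CodedStructure L} (m₀ : M.carrier)

/-- The Skolem functions of `M`, with values in `M`. -/
noncomputable def skolemFn (e : ℕ) (x : List ℕ × List ℕ) : M.carrier :=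
  ⟨skolem M.carrier (Sat g M) m₀ e x, skolem_mem m₀.2 e x⟩

theorem skolemClosed_skolemFn {G : Set ℕ}
    (hG : ∀ (q : ℕ) (l : List ℕ), (∀ j ∈ l, j ∈ G) → skolemIdx q l ∈ G) :
    SkolemClosed (skolemFn g m₀) G := by
  intro k φ e he
  refine ⟨skolemIdx (Nat.pair (k + 1) (formulaCode g Fin.val φ)) (List.ofFn e),
    hG _ _ fun j hj => ?_, fun x y h => ?_⟩
  · obtain ⟨i, rfl⟩ := (List.mem_ofFn' _ _).1 hj
    exact he i
  · have hl : ∀ z : M.carrier, (List.ofFn fun i =>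
        ((Fin.snoc (fun i => skolemFn g m₀ (e i) x) z : Fin (k + 1) → M.carrier) i : ℕ)) =
        (List.ofFn e).map (fun j => skolem M.carrier (Sat g M) m₀ j x) ++ [(z : ℕ)] := by
      intro z
      rw [List.ofFn_succ', List.map_ofFn, List.concat_eq_append]
      simp only [Fin.snoc_castSucc, Fin.snoc_last]
      rfl
    rw [← sat_ofFn g, hl] at h ⊢
    have := witness_spec (m₀ := (m₀ : ℕ)) y.2 h
    rw [← skolem_idx] at this
    exact this

variable {g}

theorem ArithDecidable.arFun_skolem (hM : ArithDecidable g M) :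
    ArFun ∅ (fun p : ℕ × List ℕ × List ℕ => skolem M.carrier (Sat g M) m₀ p.1 p.2) :=
  ArMorley.arFun_skolem (hM.ar_carrier g) (hM.ar_sat g)

/-- An ultrafilter, arithmetical on definable sets, for which the coordinates of the first list
realize a given type, and the coordinates of the second list are independent. -/
theorem exists_realizing_ultrafilter (hM : ArithDecidable g M) (hinf : M.carrier.Infinite)
    {n : ℕ} {p : Set (ParamFormula L M n)} (hp : IsArithmetical (typeCode g p))
    (hcons : TypeConsistent M p) :
    ∃ U : Ultrafilter (List ℕ × List ℕ),
      (∀ c ∈ typeCode g p, ∀ᶠ x in (U : Filter (List ℕ × List ℕ)),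
        ParamSat g M n c (List.ofFn fun i : Fin n => coord M.carrier m₀ x.1 i)) ∧
      (∀ i e, IndepOf M.carrier m₀ (skolem M.carrier (Sat g M) m₀ e) i →
        ∀ᶠ x in (U : Filter (List ℕ × List ℕ)),
          coord M.carrier m₀ x.2 i ≠ skolem M.carrier (Sat g M) m₀ e x) ∧
      Ar ∅ (fun p : ℕ × List ℕ => ∀ᶠ x in (U : Filter (List ℕ × List ℕ)),
        Sat g M p.1 (p.2.map fun j => skolem M.carrier (Sat g M) m₀ j x)) := by
  let A : ℕ → List ℕ × List ℕ → Prop := fun c x => Sat g M c.unpair.1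
    (((Encodable.decode c.unpair.2 : Option (List ℕ)).getD []).map
      fun j => skolem M.carrier (Sat g M) m₀ j x)
  let B : ℕ → List ℕ × List ℕ → Prop := fun c x =>
    (c ∈ typeCode g p →
      ParamSat g M n c (List.ofFn fun i : Fin n => coord M.carrier m₀ x.1 i)) ∧
    (IndepOf M.carrier m₀ (skolem M.carrier (Sat g M) m₀ c.unpair.2) c.unpair.1 →
      coord M.carrier m₀ x.2 c.unpair.1 ≠ skolem M.carrier (Sat g M) m₀ c.unpair.2 x)
  have hsk := hM.arFun_skolem m₀
  have hco := arFun_coord (m₀ := (m₀ : ℕ)) (hM.ar_carrier g)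
  have hA : Ar ∅ (fun q : ℕ × List ℕ × List ℕ => A q.1 q.2) :=
    (hM.ar_sat g).comp (f := fun q : ℕ × List ℕ × List ℕ => (q.1.unpair.1,
      ((Encodable.decode q.1.unpair.2 : Option (List ℕ)).getD []).map
        fun j => skolem M.carrier (Sat g M) m₀ j q.2)) (ArFun.prodMk (by fun_prop)
      (ArFun.listMap (hsk.comp (f := fun r : (ℕ × List ℕ × List ℕ) × ℕ => (r.2, r.1.2))
        (by fun_prop))
        (ArFun.decodeList (by fun_prop))))
  have htup : ArFun ∅ (fun q : ℕ × List ℕ × List ℕ =>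
      List.ofFn fun i : Fin n => coord M.carrier m₀ q.2.1 i) := by
    have h := ArFun.listMap (Y := ∅)
      (f := fun (q : ℕ × List ℕ × List ℕ) j => coord M.carrier m₀ q.2.1 j)
      (l := fun _ => List.range n) (hco.comp
      (f := fun r : (ℕ × List ℕ × List ℕ) × ℕ => (r.1.2.1, r.2)) (by fun_prop)) (by fun_prop)
    convert h using 2 with q
    refine List.ext_getElem (by simp) fun i h₁ h₂ => by simp
  have hind : Ar ∅ (fun c : ℕ =>
      IndepOf M.carrier m₀ (skolem M.carrier (Sat g M) m₀ c.unpair.2) c.unpair.1) := by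
    refine Ar.all (Ar.all (Ar.all (Ar.imp (Ar.all (Ar.imp (ArFun.eq ?_ ?_).not
      (ArFun.eq (hco.comp (f := fun r : (((ℕ × List ℕ) × List ℕ) × List ℕ) × ℕ =>
        (r.1.1.2, r.2)) ?_) (hco.comp (f := fun r : (((ℕ × List ℕ) × List ℕ) × List ℕ) × ℕ =>
        (r.1.2, r.2)) ?_)))) (ArFun.eq
      (hsk.comp (f := fun r : ((ℕ × List ℕ) × List ℕ) × List ℕ =>
        (r.1.1.1.unpair.2, r.1.1.2, r.1.2)) ?_)
      (hsk.comp (f := fun r : ((ℕ × List ℕ) × List ℕ) × List ℕ =>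
        (r.1.1.1.unpair.2, r.1.1.2, r.2)) ?_)))))
    all_goals fun_prop
  have hB : Ar ∅ (fun q : ℕ × List ℕ × List ℕ => B q.1 q.2) := by
    refine (((arReducible_iff.1 hp).comp (f := fun q : ℕ × List ℕ × List ℕ => q.1)
      (by fun_prop)).imp
      ((hM.ar_paramSat g).comp (f := fun q : ℕ × List ℕ × List ℕ => ((n, q.1),
        List.ofFn fun i : Fin n => coord M.carrier m₀ q.2.1 i)) (ArFun.prodMk (by fun_prop)
          htup))).and ((hind.comp (f := fun q : ℕ × List ℕ × List ℕ => q.1) (by fun_prop)).imp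
      (ArFun.eq (hco.comp (f := fun q : ℕ × List ℕ × List ℕ => (q.2.2, q.1.unpair.1)) (by fun_prop))
        (hsk.comp (f := fun q : ℕ × List ℕ × List ℕ => (q.1.unpair.2, q.2)) (by fun_prop))).not)
  have hfip : ∀ k, ∃ x, ∀ c < k, B c x := by
    intro k
    obtain ⟨b, hb⟩ := hcons.exists_realize g k
    obtain ⟨a, ha⟩ := exists_coord_ne hinf m₀.2 (skolem M.carrier (Sat g M) m₀)
      (List.ofFn fun i => (b i : ℕ)) k
    refine ⟨(List.ofFn fun i => (b i : ℕ), a), fun c hc => ⟨fun h => ?_, ha c hc⟩⟩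
    have := hb c hc h
    simpa only [coord_ofFn (fun i => (b i).2)] using this
  obtain ⟨U, hU, hUA⟩ := exists_ultrafilter hA hB hfip
  refine ⟨U, fun c hc => (hU c).mono fun x hx => hx.1 hc, fun i e hie =>
    (hU (Nat.pair i e)).mono fun x hx => ?_, ?_⟩
  · have := hx.2
    rw [Nat.unpair_pair] at this
    exact this hie
  · refine (hUA.comp (f := fun q : ℕ × List ℕ => Nat.pair q.1 (Encodable.encode q.2))
      (by fun_prop)).of_iff fun q => ?_
    simp [A]

theorem ElemSub.trans {M N K : CodedStructure L} (h : ElemSub M N) (h' : ElemSub N K) :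
    ElemSub M K :=
  ⟨h.subset.trans h'.subset, fun k φ a => (h.elem k φ a).trans (h'.elem k φ _)⟩

/-- Every arithmetic type over an arithmetically decidable model is realized in an extendible
elementary extension of any prescribed degree. -/
theorem ArithDecidable.exists_extensions (hM : ArithDecidable g M) (hinf : M.carrier.Infinite)
    (D : Set ℕ) {n : ℕ} {p : Set (ParamFormula L M n)} (hp : IsArithmetical (typeCode g p))
    (hcons : TypeConsistent M p) :
    ∃ N₁ N₂ : CodedStructure L, ArithDecidable g N₁ ∧ ElemSub N₂ N₁ ∧ ArEquiv N₂.carrier D ∧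
      ∃ h : ElemSub M N₂, RealizesType h.subset p := by
  obtain ⟨m, hm⟩ := hinf.nonempty
  let m₀ : M.carrier := ⟨m, hm⟩
  have : Nonempty M.carrier := ⟨m₀⟩
  obtain ⟨U, hUp, hUD, hUar⟩ := exists_realizing_ultrafilter m₀ hM hinf hp hcons
  let sk : ℕ → List ℕ × List ℕ → ℕ := skolem M.carrier (Sat g M) m₀
  have hsk : ArFun ∅ (fun p : ℕ × List ℕ × List ℕ => sk p.1 p.2) := hM.arFun_skolem m₀
  have hco := arFun_coord (m₀ := (m₀ : ℕ)) (hM.ar_carrier g)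
  let F := skolemFn g m₀
  let W : ℕ → List ℕ → Prop := fun q l => ∀ᶠ x in (U : Filter (List ℕ × List ℕ)),
    Sat g M q (l.map fun j => sk j x)
  have hmap : ∀ (k : ℕ) (e : Fin k → ℕ) (x : List ℕ × List ℕ),
      ((List.ofFn e).map fun j => sk j x) = List.ofFn fun i => (F (e i) x : ℕ) :=
    fun k e x => by rw [List.map_ofFn]; rfl
  have hW : ∀ (k : ℕ) (φ : L.Formula (Fin k)) (e : Fin k → ℕ),
      W (Nat.pair k (formulaCode g Fin.val φ)) (List.ofFn e) ↔
        ∀ᶠ x in (U : Filter (List ℕ × List ℕ)), φ.Realize fun i => F (e i) x :=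
    fun k φ e => Filter.eventually_congr (.of_forall fun x => by rw [hmap, sat_ofFn])
  let E : ℕ → ℕ → Prop := fun e e' => ∀ᶠ x in (U : Filter (List ℕ × List ℕ)), F e x = F e' x
  have hE : Equivalence E := ⟨fun _ => .of_forall fun _ => rfl, fun h => h.mono fun _ hx => hx.symm,
    fun h h' => (h.and h').mono fun _ hx => hx.1.trans hx.2⟩
  have hEar : Ar ∅ (fun p : ℕ × ℕ => E p.1 p.2) := by
    refine (hUar.comp (f := fun p : ℕ × ℕ => (Nat.pair 2 (formulaCode g Fin.val
      (Term.equal (Term.var 0) (Term.var 1) : L.Formula (Fin 2))), [p.1, p.2]))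
      (by fun_prop)).of_iff fun p => ?_
    have h : W (Nat.pair 2 (formulaCode g Fin.val (Term.equal (Term.var 0) (Term.var 1) :
        L.Formula (Fin 2)))) [p.1, p.2] ↔ E p.1 p.2 := by
      simpa [Formula.realize_equal, E] using
        hW 2 (Term.equal (Term.var 0) (Term.var 1)) ![p.1, p.2]
    exact h
  obtain ⟨κ, hκar, hκ, hκM, hκinf⟩ := exists_naming hE hEar (hM.ar_carrier g) M.compl_infinite
    (c := fun m => Nat.pair 0 m) (by fun_prop) (fun m hm m' hm' h => by
      obtain ⟨x, hx⟩ := h.exists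
      have hx := congrArg Subtype.val hx
      simpa only [F, skolemFn, skolem_const hm, skolem_const hm'] using hx)
  let G : Set ℕ := {e | ∀ l a a', (∀ i, i ∈ D → coord M.carrier m₀ a i = coord M.carrier m₀ a' i) →
    sk e (l, a) = sk e (l, a')}
  have hGconst : ∀ m ∈ M.carrier, Nat.pair 0 m ∈ G := fun m hm l a a' _ => by
    simp only [sk, skolem_const hm]
  have hGfst : ∀ i, Nat.pair 1 i ∈ G := fun i l a a' _ => by
    simp only [sk, skolem_fst]
  have hGsnd : ∀ i ∈ D, Nat.pair 2 i ∈ G := fun i hi l a a' h => by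
    simp only [sk, skolem_snd, h i hi]
  have hG : ∀ (q : ℕ) (l : List ℕ), (∀ j ∈ l, j ∈ G) → skolemIdx q l ∈ G := by
    intro q l hl y a a' h
    simp only [sk, skolem_idx]
    exact congrArg _ (List.map_congr_left fun j hj => hl j hj y a a' h)
  have hGar : Ar D (fun e => e ∈ G) := by
    refine Ar.all (Ar.all (Ar.all (Ar.imp (Ar.all (Ar.imp (Ar.oracle ?_)
      (ArFun.eq (hco.mono.comp (f := fun r : (((ℕ × List ℕ) × List ℕ) × List ℕ) × ℕ =>
        (r.1.1.2, r.2)) ?_) (hco.mono.comp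
        (f := fun r : (((ℕ × List ℕ) × List ℕ) × List ℕ) × ℕ => (r.1.2, r.2)) ?_)))) (ArFun.eq
      (hsk.mono.comp (f := fun r : ((ℕ × List ℕ) × List ℕ) × List ℕ =>
        (r.1.1.1, r.1.1.2, r.1.2)) ?_)
      (hsk.mono.comp (f := fun r : ((ℕ × List ℕ) × List ℕ) × List ℕ =>
        (r.1.1.1, r.1.1.2, r.2)) ?_)))))
    all_goals fun_prop
  obtain ⟨N₁, hN₁, h₁⟩ := (skolemClosed_skolemFn g m₀ (G := Set.univ)
    fun _ _ _ => trivial).exists_model hκ hκinf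
  obtain ⟨N₂, hN₂, h₂⟩ := (skolemClosed_skolemFn g m₀ hG).exists_model hκ hκinf
  have hN₁mem : ∀ e, κ e ∈ N₁.carrier := fun e => hN₁ ▸ ⟨e, trivial, rfl⟩
  have hN₂mem : ∀ e ∈ G, κ e ∈ N₂.carrier := fun e he => hN₂ ▸ ⟨e, he, rfl⟩
  have hsub : ∀ {m}, m ∈ M.carrier → m ∈ N₂.carrier := fun {m} hm => by
    have := hN₂mem _ (hGconst m hm)
    rwa [hκM m hm] at this
  have hFM : ∀ (a : M.carrier) x, F (Nat.pair 0 a) x = a :=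
    fun a x => Subtype.ext (skolem_const a.2 x)
  refine ⟨N₁, N₂, ?_, ⟨?_, fun k φ a => ?_⟩, ⟨?_, ?_⟩, ⟨fun m => hsub, fun k φ a => ?_⟩, ?_⟩
  · refine arReducible_iff.2 ((Ar.ex (R := fun (c : ℕ) (q : ℕ × List ℕ) =>
      c = Nat.pair q.1 (Encodable.encode (q.2.map κ)) ∧ W q.1 q.2) ((ArFun.eq (by fun_prop)
      (ArFun.pair (by fun_prop) (ArFun.encode (ArFun.listMap
        (hκar.comp (f := fun r : (ℕ × ℕ × List ℕ) × ℕ => r.2) (by fun_prop))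
        (by fun_prop))))).and (hUar.comp (f := fun r : ℕ × ℕ × List ℕ => r.2)
        (by fun_prop)))).of_iff fun c => ?_)
    constructor
    · rintro ⟨⟨q, l⟩, rfl, hq⟩
      obtain ⟨x, hx⟩ := hq.exists
      obtain ⟨k, φ, a, rfl, hl, -⟩ := (sat_iff g).1 hx
      have hlen : l.length = k := by simpa using congrArg List.length hl
      obtain ⟨e, rfl⟩ : ∃ e : Fin k → ℕ, l = List.ofFn e := by
        subst hlen
        exact ⟨l.get, (List.ofFn_get l).symm⟩
      refine ⟨k, φ, fun i => ⟨κ (e i), hN₁mem _⟩, ?_,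
        (h₁ k φ _ e (fun _ => trivial) fun _ => rfl).2 ((hW k φ e).1 hq)⟩
      rw [List.map_ofFn]
      rfl
    · rintro ⟨k, φ, a, rfl, ha⟩
      choose e _ he using fun i => (Set.ext_iff.1 hN₁ (a i)).1 (a i).2
      refine ⟨(Nat.pair k (formulaCode g Fin.val φ), List.ofFn e), ?_,
        (hW k φ e).2 ((h₁ k φ a e (fun _ => trivial) fun i => (he i).symm).1 ha)⟩
      rw [List.map_ofFn]
      exact congrArg _ (congrArg _ (funext fun i => (he i).symm))
  · rw [hN₁, hN₂]
    exact Set.image_mono (Set.subset_univ _)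
  · choose e he' he using fun i => (Set.ext_iff.1 hN₂ (a i)).1 (a i).2
    exact (h₂ k φ a e he' fun i => (he i).symm).trans
      (h₁ k φ _ e (fun _ => trivial) fun i => (he i).symm).symm
  · refine arReducible_iff.2 ((Ar.ex (R := fun (m e : ℕ) => e ∈ G ∧ κ e = m)
      ((hGar.comp (f := fun r : ℕ × ℕ => r.2) (by fun_prop)).and
        (ArFun.eq (hκar.mono.comp (by fun_prop)) (by fun_prop)))).of_iff fun m => ?_)
    rw [hN₂]
    rfl
  · refine arReducible_iff.2 ((Ar.oracle (f := fun i => κ (Nat.pair 2 i))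
      (hκar.mono.comp (by fun_prop))).of_iff fun i => ⟨fun h => ?_, fun h => hN₂mem _ (hGsnd i h)⟩)
    rw [hN₂] at h
    obtain ⟨e, he, h⟩ := h
    by_contra hi
    have h₃ := hUD i e fun l a a' haa' => he l a a' fun j hj => haa' j fun hji => hi (hji ▸ hj)
    obtain ⟨x, hx, hx'⟩ := (h₃.and ((hκ _ _).1 h)).exists
    have hx' := congrArg Subtype.val hx'
    simp only [F, skolemFn, skolem_snd] at hx'
    exact hx hx'.symm
  · refine ((h₂ k φ _ (fun i => Nat.pair 0 (a i)) (fun i => hGconst _ (a i).2)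
      fun i => (hκM _ (a i).2).symm).trans ?_).symm
    refine (Filter.eventually_congr (.of_forall fun x => ?_)).trans Filter.eventually_const
    exact iff_of_eq (congrArg φ.Realize (funext fun i => hFM (a i) x))
  · refine ⟨fun j => ⟨κ (Nat.pair 1 j), hN₂mem _ (hGfst j)⟩, fun q hq => ?_⟩
    let ψ : L.Formula (Fin (n + q.1)) := rename finSumFinEquiv q.2.1
    have h₃ := h₂ _ ψ (Sum.elim (fun j : Fin n => ⟨κ (Nat.pair 1 j), hN₂mem _ (hGfst j)⟩)
      (fun i => ⟨q.2.2 i, hsub (q.2.2 i).2⟩) ∘ finSumFinEquiv.symm)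
      (Sum.elim (fun j : Fin n => Nat.pair 1 j) (fun i => Nat.pair 0 (q.2.2 i)) ∘
        finSumFinEquiv.symm) (fun i => ?_) (fun i => ?_)
    · have h₄ := h₃.2 ((hUp _ ⟨q, hq, rfl⟩).mono fun x hx => ?_)
      · have h₅ := (realize_rename _ _ _ _).1 h₄
        rwa [Function.comp_assoc, Equiv.symm_comp_self, Function.comp_id] at h₅
      · have h₆ := (paramSat_pfCode g (Set.Subset.refl _)
          (fun i : Fin n => ⟨coord M.carrier m₀ x.1 i, coord_mem m₀.2 _ _⟩) q).1 hx
        refine (realize_rename _ _ _ _).2 ?_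
        refine (iff_of_eq (congrArg (fun v => Formula.Realize q.2.1 v)
          (funext fun i => ?_))).2 h₆
        rcases i with i | i
        · exact Subtype.ext (by simp [skolemFn, skolem_fst])
        · exact Subtype.ext (by simp [skolemFn, skolem_const])
    · rw [Function.comp_apply]
      generalize finSumFinEquiv.symm i = i
      rcases i with i | i
      · exact hGfst i
      · exact hGconst _ (q.2.2 i).2
    · simp only [Function.comp_apply]
      generalize finSumFinEquiv.symm i = i
      rcases i with i | i
      · rfl
      · exact (hκM _ (q.2.2 i).2).symm

end Extension

/-! ## The types realized in an elementary extension -/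

section Realized
variable {M N : CodedStructure L}

/-- The inclusion of an elementary substructure. -/
def ElemSub.toEEmb (h : ElemSub M N) : EEmb L M.carrier M.struc N.carrier N.struc where
  toFun a := ⟨a, h.subset a.2⟩
  map_formula' k φ a := (h.elem k φ a).symm

theorem ElemSub.realize_iff (h : ElemSub M N) {α : Type} (φ : L.Formula α)
    (a : α → M.carrier) :
    φ.Realize (fun i => (⟨a i, h.subset (a i).2⟩ : N.carrier)) ↔ φ.Realize a :=
  ElementaryEmbedding.map_formula (M := M.carrier) (N := N.carrier) h.toEEmb φ a

theorem ElemSub.models_iff (h : ElemSub M N) {T : L.Theory} : N.Models T ↔ M.Models T :=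
  forall₂_congr fun φ _ =>
    (ElementaryEmbedding.map_sentence (M := M.carrier) (N := N.carrier) h.toEEmb φ).symm

theorem ElemSub.refl (M : CodedStructure L) : ElemSub M M := ⟨subset_rfl, fun _ _ _ => Iff.rfl⟩

theorem TypeConsistent.mono {n : ℕ} {p q : Set (ParamFormula L M n)} (h : TypeConsistent M q)
    (hpq : p ⊆ q) : TypeConsistent M p := by
  obtain ⟨K, SK, j, b, hb⟩ := h
  exact ⟨K, SK, j, b, fun r hr => hb r (hpq hr)⟩

/-- The type over `A` of a tuple in an extension of `M`. -/
def typeOver (h : M.carrier ⊆ N.carrier) (A : Set ℕ) {n : ℕ} (b : Fin n → N.carrier) :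
    Set (ParamFormula L M n) :=
  {q | paramsIn A q ∧
    q.2.1.Realize (Sum.elim b (fun i => (⟨q.2.2 i, h (q.2.2 i).2⟩ : N.carrier)))}

theorem ElemSub.isNType_typeOver (h : ElemSub M N) (A : Set ℕ) {n : ℕ} (b : Fin n → N.carrier) :
    IsNType M A n (typeOver h.subset A b) := by
  refine ⟨fun q hq => hq.1, ⟨N.carrier, N.struc, h.toEEmb, b, fun q hq => hq.2⟩, ?_⟩
  rintro ⟨k, φ, a⟩ hqA hq ⟨K, SK, j, c, hc⟩
  have h₁ := hc ⟨k, φ.not, a⟩ (Or.inr ⟨hqA, fun h' => hq ⟨hqA, h'⟩⟩)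
  exact h₁ (hc _ (Or.inl rfl))

theorem IsNType.eq_of_subset {A : Set ℕ} {n : ℕ} {p q : Set (ParamFormula L M n)}
    (hp : IsNType M A n p) (hq : IsNType M A n q) (h : p ⊆ q) : p = q := by
  refine h.antisymm fun r hr => ?_
  by_contra hrp
  exact hp.2.2 r (hq.1 r hr) hrp (hq.2.1.mono (Set.insert_subset hr h))

theorem mem_typeCode_typeOver (g : GoedelCoding L) (h : M.carrier ⊆ N.carrier) {A : Set ℕ}
    (hA : A ⊆ M.carrier) {n : ℕ} (b : Fin n → N.carrier) (c : ℕ) :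
    c ∈ typeCode g (typeOver h A b) ↔ ParamSat g N n c (List.ofFn fun i => (b i : ℕ)) ∧
      ∀ m ∈ (Encodable.decode c.unpair.2 : Option (List ℕ)).getD [], m ∈ A := by
  have hdec : ∀ {k : ℕ} (a : Fin k → ℕ),
      (Encodable.decode (tupleCode a) : Option (List ℕ)).getD [] = List.ofFn a := fun a => by
    rw [tupleCode, listCode, Encodable.encodek, Option.getD_some]
  constructor
  · rintro ⟨q, ⟨hqA, hq⟩, rfl⟩
    refine ⟨(paramSat_pfCode g h b q).2 hq, ?_⟩
    rw [pfCode, Nat.unpair_pair, hdec]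
    simpa [paramsIn] using hqA
  · rintro ⟨hc, hcA⟩
    obtain ⟨k, φ, a, rfl, hφ⟩ := (paramSat_iff g).1 hc
    rw [Nat.unpair_pair, hdec] at hcA
    have hcA : ∀ i, (a i : ℕ) ∈ A := by simpa using hcA
    exact ⟨⟨k, φ, fun i => ⟨a i, hA (hcA i)⟩⟩, ⟨hcA, hφ⟩, rfl⟩

theorem CodedIso.realize_iff (f : CodedIso M N) {α : Type} (φ : L.Formula α)
    (a : α → M.carrier) : φ.Realize (f.toFun ∘ a) ↔ φ.Realize a := by
  let F : M.carrier ≃[L] N.carrier :=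
    { toFun := f.toFun
      invFun := f.invFun
      left_inv := f.left_inv
      right_inv := f.right_inv
      map_fun' := f.map_fun
      map_rel' := fun r v => (f.map_rel r v).symm }
  exact StrongHomClass.realize_formula F φ

theorem typeCode_typeOver_isArithmetical {g : GoedelCoding L} (hN : ArithDecidable g N)
    (h : M.carrier ⊆ N.carrier) {A : Set ℕ} (hA : A ⊆ M.carrier) (hAar : IsArithmetical A)
    (m₀ : N.carrier) : ∃ X : Set ℕ, IsArithmetical X ∧ ∀ n i, tripleSection X n i =
      typeCode g (typeOver h A fun t : Fin n =>
        (⟨coord N.carrier m₀ ((Encodable.decode i : Option (List ℕ)).getD []) t,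
          coord_mem m₀.2 _ _⟩ : N.carrier)) := by
  let tup : ℕ × ℕ → List ℕ := fun p => (List.range p.1).map
    (coord N.carrier m₀ ((Encodable.decode p.2 : Option (List ℕ)).getD []))
  have htup : ArFun ∅ tup := ArFun.listMap ((arFun_coord (hN.ar_carrier g)).comp
    (f := fun r : (ℕ × ℕ) × ℕ => ((Encodable.decode r.1.2 : Option (List ℕ)).getD [], r.2))
    (ArFun.prodMk (ArFun.decodeList (by fun_prop)) (by fun_prop)))
    ((ArFun.of_primrec Primrec.list_range).comp (by fun_prop))
  refine ⟨{x | ParamSat g N x.unpair.1 x.unpair.2.unpair.2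
      (tup (x.unpair.1, x.unpair.2.unpair.1)) ∧ ∀ t m : ℕ,
      ((Encodable.decode x.unpair.2.unpair.2.unpair.2 : Option (List ℕ)).getD [])[t]? = some m →
        m ∈ A}, ?_, fun n i => ?_⟩
  · refine arReducible_iff.2 (((hN.ar_paramSat g).comp (f := fun x : ℕ =>
      ((x.unpair.1, x.unpair.2.unpair.2), tup (x.unpair.1, x.unpair.2.unpair.1)))
      (by fun_prop)).and (Ar.all (Ar.all ((ArFun.eq (ArFun.getElem? (ArFun.decodeList ?_) ?_)
        ?_).imp ((arReducible_iff.1 hAar).comp ?_)))))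
    all_goals fun_prop
  · ext c
    rw [mem_typeCode_typeOver g h hA]
    have htup' : tup (n, i) = List.ofFn fun t : Fin n =>
        coord N.carrier m₀ ((Encodable.decode i : Option (List ℕ)).getD []) t :=
      List.ext_getElem (by simp [tup]) fun t h₁ h₂ => by simp [tup]
    simp only [tripleSection, Set.mem_ofPred_eq, Nat.unpair_pair, htup',
      List.mem_iff_getElem?, forall_exists_index]
    exact and_congr_right fun _ => forall_comm

end Realized

/-- **Categoricity at one nonzero arithmetic degree implies arithmetical stability.** -/
theorem categoricity_implies_arithmetical_stability
    (L : FirstOrder.Language) (g : GoedelCoding L) (hL : ArithLang g)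
    (T : L.Theory) (hT : ArithTheory g T) (hcomp : T.IsComplete)
    (hnf : NoFiniteModels L T)
    (D : Set ℕ) (hD : ¬ IsArithmetical D) (hcat : DCategorical g T D) :
    ArithStable g T := by
  intro M hM hMT A hA hAar
  have hinf : M.carrier.Infinite := Set.infinite_coe_iff.1 (hnf _ M.struc hMT)
  have hempty : IsArithmetical (typeCode g (∅ : Set (ParamFormula L M 0))) :=
    arReducible_iff.2 ((ArFun.eq (f := fun _ : ℕ => 0) (g := fun _ => 1) (ArFun.const 0)
      (ArFun.const 1)).of_iff fun c => by simp [typeCode])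
  obtain ⟨N₁, M₁, hN₁, hM₁N₁, hM₁D, hMM₁, -⟩ := hM.exists_extensions hinf D hempty
    ⟨M.carrier, M.struc, (ElemSub.refl M).toEEmb, Fin.elim0, fun _ h => h.elim⟩
  have hMN₁ := hMM₁.trans hM₁N₁
  obtain ⟨m, hm⟩ := hinf.nonempty
  obtain ⟨X, hX, hXsec⟩ := typeCode_typeOver_isArithmetical hN₁ hMN₁.subset hA hAar
    ⟨m, hMN₁.subset hm⟩
  refine ⟨X, hX, fun n _ i => ⟨_, hMN₁.isNType_typeOver A _, ?_, hXsec n i⟩,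
    fun n _ p hp hpar => ?_⟩
  · rw [← hXsec]
    exact arReducible_iff.2 ((arReducible_iff.1 hX).comp
      (f := fun c => Nat.pair n (Nat.pair i c)) (by fun_prop))
  obtain ⟨N₂, M₂, hN₂, hM₂N₂, hM₂D, hMM₂, b, hb⟩ := hM.exists_extensions hinf D hpar hp.2.1
  have hM₁T := hMM₁.models_iff.2 hMT
  have hM₂T := hMM₂.models_iff.2 hMT
  obtain ⟨f, -, hf⟩ := hcat M M₁ M₂ hM hMT hM₁T ⟨N₁, hN₁, hM₁N₁.models_iff.2 hM₁T, hM₁N₁⟩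
    hM₂T ⟨N₂, hN₂, hM₂N₂.models_iff.2 hM₂T, hM₂N₂⟩ hMM₁ hMM₂ hM₁D hM₂D
  refine ⟨Encodable.encode (List.ofFn fun t => (f.invFun (b t) : ℕ)), ?_⟩
  rw [hXsec]
  refine congrArg _ (hp.eq_of_subset (hMN₁.isNType_typeOver A _) fun q hq => ⟨hp.1 q hq, ?_⟩).symm
  let v : Fin n ⊕ Fin q.1 → M₁.carrier :=
    Sum.elim (fun t => f.invFun (b t)) fun t => ⟨q.2.2 t, hMM₁.subset (q.2.2 t).2⟩
  have hv : f.toFun ∘ v = Sum.elim b fun t => ⟨q.2.2 t, hMM₂.subset (q.2.2 t).2⟩ := by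
    funext t
    rcases t with t | t
    · exact f.right_inv _
    · exact Subtype.ext (hf _ (q.2.2 t).2 _)
  have h₁ := (f.realize_iff q.2.1 v).1 (hv ▸ hb q hq)
  have h₂ := (hM₁N₁.realize_iff q.2.1 v).2 h₁
  refine (iff_of_eq (congrArg (fun v => Formula.Realize q.2.1 v) (funext fun t => ?_))).1 h₂
  rcases t with t | t
  · refine Subtype.ext ?_
    simp only [Encodable.encodek, Option.getD_some, Sum.elim_inl]
    exact (coord_ofFn (fun t => hM₁N₁.subset (f.invFun (b t)).2) t).symm
  · rfl

end ArMorley
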